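/- arXiv:1604.00960 — 2 statements merged into one kernel-verified Lean document; each statement's English description precedes it below -/
import Mathlib

section
/- Let m ≥ 3 and let Z₁, …, Zₘ be pairwise interior-disjoint nondegenerate closed axis-parallel rectangles in the plane ℝ². Then the set of connected components of the complement ℝ² \ (Z₁ ∪ ⋯ ∪ Zₘ) is finite and has at most m − 2 elements. -/
/-- A nondegenerate closed axis-parallel rectangle in ℝ²:
a set of the form [a, b] × [c, d] with a < b and c < d. -/
def IsRect (S : Set (ℝ × ℝ)) : Prop :=
  ∃ a b c d : ℝ, a < b ∧ c < d ∧ S = Set.Icc a b ×ˢ Set.Icc c d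

open Set

/-- Combinatorial data of a maximally extended family of rectangles in the box `[-M, M]²`. -/
structure ExtFam {ι : Type*} (a b c d : ι → ℝ) (M : ℝ) : Prop where
  hab : ∀ i, a i < b i
  hcd : ∀ i, c i < d i
  la : ∀ i, -M ≤ a i
  bM : ∀ i, b i ≤ M
  lc : ∀ i, -M ≤ c i
  dM : ∀ i, d i ≤ M
  sep : ∀ i j, i ≠ j → b i ≤ a j ∨ b j ≤ a i ∨ d i ≤ c j ∨ d j ≤ c i
  up : ∀ i, d i = M ∨ ∃ j, d i ≤ c j ∧ a j < b i ∧ a i < b j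
  down : ∀ i, c i = -M ∨ ∃ j, d j ≤ c i ∧ a j < b i ∧ a i < b j
  right : ∀ i, b i = M ∨ ∃ j, b i ≤ a j ∧ c j < d i ∧ c i < d j
  left : ∀ i, a i = -M ∨ ∃ j, b j ≤ a i ∧ c j < d i ∧ c i < d j

theorem ExtFam.neg {ι : Type*} {a b c d : ι → ℝ} {M : ℝ} (h : ExtFam a b c d M) :
    ExtFam (fun i => - b i) (fun i => - a i) (fun i => - d i) (fun i => - c i) M where
  hab i := by have := h.hab i; simpa
  hcd i := by have := h.hcd i; simpa
  la i := by have := h.bM i; simpa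
  bM i := by have := h.la i; linarith
  lc i := by have := h.dM i; simpa
  dM i := by have := h.lc i; linarith
  sep i j hij := by
    have := h.sep i j hij
    simp only [neg_le_neg_iff]; tauto
  up i := by
    rcases h.down i with h | ⟨j, h1, h2, h3⟩
    · left; linarith
    · right; exact ⟨j, by linarith, by linarith, by linarith⟩
  down i := by
    rcases h.up i with h | ⟨j, h1, h2, h3⟩
    · left; linarith
    · right; exact ⟨j, by linarith, by linarith, by linarith⟩
  right i := by
    rcases h.left i with h | ⟨j, h1, h2, h3⟩
    · left; linarith
    · right; exact ⟨j, by linarith, by linarith, by linarith⟩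
  left i := by
    rcases h.right i with h | ⟨j, h1, h2, h3⟩
    · left; linarith
    · right; exact ⟨j, by linarith, by linarith, by linarith⟩

theorem ExtFam.swap {ι : Type*} {a b c d : ι → ℝ} {M : ℝ} (h : ExtFam a b c d M) :
    ExtFam c d a b M where
  hab := h.hcd
  hcd := h.hab
  la := h.lc
  bM := h.dM
  lc := h.la
  dM := h.bM
  sep i j hij := by have := h.sep i j hij; tauto
  up := h.right
  down := h.left
  right := h.up
  left := h.down

section
variable {ι : Type*} [Fintype ι] {a b c d : ι → ℝ} {M : ℝ}

theorem ExtFam.exists_top [Nonempty ι] (h : ExtFam a b c d M) : ∃ t, d t = M := by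
  obtain ⟨t, -, ht⟩ := Finset.exists_max_image (Finset.univ : Finset ι) d Finset.univ_nonempty
  refine ⟨t, ?_⟩
  rcases h.up t with h1 | ⟨j, h1, -, -⟩
  · exact h1
  · have := ht j (Finset.mem_univ _)
    have := h.hcd j
    linarith

theorem ExtFam.top_unique (h : ExtFam a b c d M) {t : ι} (ht : ∀ i, d i = M → i = t) :
    (∀ i, i ≠ t → d i ≤ c t) ∧ a t = -M ∧ b t = M := by
  classical
  have h1 : ∀ i, i ≠ t → d i ≤ c t := by
    by_contra! hcon
    obtain ⟨i0, hi0, hi0'⟩ := hcon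
    obtain ⟨i, hi, hmax⟩ := Finset.exists_max_image
      (Finset.univ.filter (fun i => i ≠ t ∧ c t < d i)) d ⟨i0, by simp [hi0, hi0']⟩
    simp only [Finset.mem_filter, Finset.mem_univ, true_and] at hi hmax
    rcases h.up i with h2 | ⟨j, h2, -, -⟩
    · exact hi.1 (ht i h2)
    · have hj : j ≠ t := by
        rintro rfl
        linarith [hi.2]
      have := h.hcd j
      have := hmax j ⟨hj, by linarith [hi.2]⟩
      linarith
  refine ⟨h1, ?_, ?_⟩
  · rcases h.left t with h2 | ⟨j, h2, h3, h4⟩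
    · exact h2
    · have : j ≠ t := by
        rintro rfl
        linarith [h.hab j]
      linarith [h1 j this]
  · rcases h.right t with h2 | ⟨j, h2, h3, h4⟩
    · exact h2
    · have : j ≠ t := by
        rintro rfl
        linarith [h.hab j]
      linarith [h1 j this]

open Classical in
theorem ExtFam.waste_of_top (h : ExtFam a b c d M) (hc : 3 ≤ Fintype.card ι)
    (hT : ∃ t, ∀ i, d i = M → i = t) :
    5 ≤ (Finset.univ.filter (fun i => d i = M ∨ a i = -M)).card
      + (Finset.univ.filter (fun i => c i = -M ∨ b i = M)).card := by
  obtain ⟨t, ht⟩ := hT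
  have hne : Nonempty ι := ⟨t⟩
  have htM : d t = M := by
    obtain ⟨t', ht'⟩ := h.exists_top
    rwa [← ht t' ht']
  obtain ⟨ht1, ht2, ht3⟩ := h.top_unique ht
  have hother : ∃ i, i ≠ t := by
    have : 1 < Fintype.card ι := by omega
    exact Fintype.exists_ne_of_one_lt_card this t
  have hct : c t ≠ -M := by
    intro hh
    obtain ⟨i, hi⟩ := hother
    linarith [ht1 i hi, h.lc i, h.hcd i]
  by_cases hB : ∃ s, ∀ i, c i = -M → i = s
  · obtain ⟨s, hs⟩ := hB
    have hsM : c s = -M := by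
      obtain ⟨s', hs'⟩ := h.neg.exists_top
      have h2 : c s' = -M := by linarith
      rwa [← hs s' h2]
    have hst : s ≠ t := by rintro rfl; exact hct hsM
    obtain ⟨hs1, hs2, hs3⟩ := h.neg.top_unique (t := s) (fun i hi => hs i (by linarith))
    have hth : (Finset.univ.filter (fun i => i ≠ t ∧ i ≠ s)).Nonempty := by
      by_contra hcon
      rw [Finset.not_nonempty_iff_eq_empty] at hcon
      have : (Finset.univ : Finset ι) ⊆ {t, s} := by
        intro i _
        by_contra hi
        have : i ∈ (Finset.univ.filter (fun i => i ≠ t ∧ i ≠ s)) := by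
          simp at hi ⊢; tauto
        rw [hcon] at this
        simp at this
      have h2 := Finset.card_le_card this
      have h3 : ({t, s} : Finset ι).card ≤ 2 := Finset.card_le_two
      rw [Finset.card_univ] at h2
      omega
    obtain ⟨l, hl, hmin⟩ := Finset.exists_min_image _ a hth
    simp only [Finset.mem_filter, Finset.mem_univ, true_and] at hl hmin
    have hlM : a l = -M := by
      rcases h.left l with h2 | ⟨j, h2, h3, h4⟩
      · exact h2
      · have hjt : j ≠ t := by
          rintro rfl
          linarith [ht1 l hl.1]
        have hjs : j ≠ s := by
          rintro rfl
          linarith [hs1 l hl.2]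
        linarith [hmin j ⟨hjt, hjs⟩, h.hab j]
    have e1 : ({t, s, l} : Finset ι) ⊆ Finset.univ.filter (fun i => d i = M ∨ a i = -M) := by
      intro i hi
      simp only [Finset.mem_insert, Finset.mem_singleton] at hi
      simp only [Finset.mem_filter, Finset.mem_univ, true_and]
      rcases hi with rfl | rfl | rfl
      · exact Or.inl htM
      · right; linarith
      · exact Or.inr hlM
    have e2 : ({t, s} : Finset ι) ⊆ Finset.univ.filter (fun i => c i = -M ∨ b i = M) := by
      intro i hi
      simp only [Finset.mem_insert, Finset.mem_singleton] at hi
      simp only [Finset.mem_filter, Finset.mem_univ, true_and]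
      rcases hi with rfl | rfl
      · exact Or.inr ht3
      · exact Or.inl hsM
    have c1 : ({t, s, l} : Finset ι).card = 3 := Finset.card_eq_three.2
      ⟨t, s, l, hst.symm, hl.1.symm, hl.2.symm, rfl⟩
    have c2 : ({t, s} : Finset ι).card = 2 := Finset.card_pair hst.symm
    have := Finset.card_le_card e1
    have := Finset.card_le_card e2
    omega
  · push Not at hB
    obtain ⟨s1, hs1, -⟩ := hB t
    obtain ⟨s2, hs2, h12⟩ := hB s1
    have hs1t : s1 ≠ t := by rintro rfl; exact hct hs1
    have hs2t : s2 ≠ t := by rintro rfl; exact hct hs2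
    obtain ⟨i0, hi0⟩ := hother
    obtain ⟨l, hl, hmin⟩ := Finset.exists_min_image (Finset.univ.filter (fun i => i ≠ t)) a
      ⟨i0, by simp [hi0]⟩
    simp only [Finset.mem_filter, Finset.mem_univ, true_and] at hl hmin
    have hlM : a l = -M := by
      rcases h.left l with h2 | ⟨j, h2, h3, h4⟩
      · exact h2
      · have hjt : j ≠ t := by
          rintro rfl
          linarith [ht1 l hl]
        linarith [hmin j hjt, h.hab j]
    have e1 : ({t, l} : Finset ι) ⊆ Finset.univ.filter (fun i => d i = M ∨ a i = -M) := by
      intro i hi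
      simp only [Finset.mem_insert, Finset.mem_singleton] at hi
      simp only [Finset.mem_filter, Finset.mem_univ, true_and]
      rcases hi with rfl | rfl
      · exact Or.inl htM
      · exact Or.inr hlM
    have e2 : ({t, s1, s2} : Finset ι) ⊆ Finset.univ.filter (fun i => c i = -M ∨ b i = M) := by
      intro i hi
      simp only [Finset.mem_insert, Finset.mem_singleton] at hi
      simp only [Finset.mem_filter, Finset.mem_univ, true_and]
      rcases hi with rfl | rfl | rfl
      · exact Or.inr ht3
      · exact Or.inl hs1
      · exact Or.inl hs2
    have c1 : ({t, s1, s2} : Finset ι).card = 3 := Finset.card_eq_three.2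
      ⟨t, s1, s2, hs1t.symm, hs2t.symm, h12.symm, rfl⟩
    have c2 : ({t, l} : Finset ι).card = 2 := Finset.card_pair hl.symm
    have := Finset.card_le_card e1
    have := Finset.card_le_card e2
    omega

open Classical in
theorem ExtFam.three_le (h : ExtFam a b c d M) (hne : Nonempty ι)
    (hT : ¬ ∃ t, ∀ i, d i = M → i = t) (hL : ¬ ∃ t, ∀ i, a i = -M → i = t) :
    3 ≤ (Finset.univ.filter (fun i => d i = M ∨ a i = -M)).card := by
  obtain ⟨i0⟩ := hne
  push Not at hT hL
  obtain ⟨t1, ht1, -⟩ := hT i0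
  obtain ⟨t2, ht2, h12⟩ := hT t1
  have key : ∃ l, a l = -M ∧ l ≠ t1 ∧ l ≠ t2 := by
    by_contra! hcon
    obtain ⟨l1, hl1, -⟩ := hL i0
    obtain ⟨l2, hl2, hl12⟩ := hL l1
    have : a t1 = -M ∧ a t2 = -M := by
      have e1 := hcon l1 hl1
      have e2 := hcon l2 hl2
      by_cases q1 : l1 = t1
      · subst q1
        exact ⟨hl1, e2 hl12 ▸ hl2⟩
      · have q2 := e1 q1
        subst q2
        by_cases q3 : l2 = t1
        · subst q3; exact ⟨hl2, hl1⟩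
        · exact absurd (e2 q3) hl12
    obtain ⟨q1, q2⟩ := this
    have := h.hab t1
    have := h.hab t2
    have := h.hcd t1
    have := h.hcd t2
    rcases h.sep t1 t2 h12.symm with q | q | q | q <;> linarith
  obtain ⟨l, hl, hl1, hl2⟩ := key
  have e2 : ({t1, t2, l} : Finset ι) ⊆ Finset.univ.filter (fun i => d i = M ∨ a i = -M) := by
    intro i hi
    simp only [Finset.mem_insert, Finset.mem_singleton] at hi
    simp only [Finset.mem_filter, Finset.mem_univ, true_and]
    rcases hi with rfl | rfl | rfl
    · exact Or.inl ht1
    · exact Or.inl ht2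
    · exact Or.inr hl
  have c1 : ({t1, t2, l} : Finset ι).card = 3 := Finset.card_eq_three.2
    ⟨t1, t2, l, h12.symm, hl1.symm, hl2.symm, rfl⟩
  have := Finset.card_le_card e2
  omega

open Classical in
theorem ExtFam.waste (h : ExtFam a b c d M) (hc : 3 ≤ Fintype.card ι) :
    5 ≤ (Finset.univ.filter (fun i => d i = M ∨ a i = -M)).card
      + (Finset.univ.filter (fun i => c i = -M ∨ b i = M)).card := by
  have hne : Nonempty ι := Fintype.card_pos_iff.1 (by omega)
  have n1 : ∀ x : ℝ, (-x = M ↔ x = -M) := fun x => by constructor <;> intro <;> linarith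
  have n2 : ∀ x : ℝ, (-x = -M ↔ x = M) := fun x => by constructor <;> intro <;> linarith
  by_cases hT : ∃ t, ∀ i, d i = M → i = t
  · exact h.waste_of_top hc hT
  by_cases hB : ∃ t, ∀ i, c i = -M → i = t
  · have := h.neg.waste_of_top hc (by simpa only [n1] using hB)
    simp only [n1, n2] at this
    omega
  by_cases hR : ∃ t, ∀ i, b i = M → i = t
  · have := h.swap.waste_of_top hc hR
    simp only [or_comm (a := b _ = M), or_comm (a := a _ = -M)] at this
    omega
  by_cases hL : ∃ t, ∀ i, a i = -M → i = t
  · have := h.neg.swap.waste_of_top hc (by simpa only [n1] using hL)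
    simp only [n1, n2] at this
    simp only [or_comm (b := d _ = M), or_comm (b := c _ = -M)] at this
    omega
  have := h.three_le hne hT hL
  have h2 := h.neg.three_le hne (by simpa only [n1] using hB) (by simpa only [n2] using hR)
  simp only [n1, n2] at h2
  omega
end

theorem subset_of_frontier_disjoint {X : Type*} [TopologicalSpace X] {t H : Set X}
    (ht : IsPreconnected t) (hH : IsOpen H) (hm : (t ∩ H).Nonempty)
    (hf : ∀ p ∈ t, p ∉ frontier H) : t ⊆ H := by
  refine ht.subset_left_of_subset_union hH (isClosed_closure (s := H)).isOpen_compl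
    (disjoint_compl_right.mono_left subset_closure) ?_ hm
  intro p hp
  by_cases h : p ∈ H
  · exact Or.inl h
  · right
    intro hc
    exact hf p hp ⟨hc, by rwa [hH.interior_eq]⟩

/-- A family of rectangles in the box `[-M, M]²`, with a family of bounded holes. -/
structure HoleSys {ι J : Type*} (a b c d : ι → ℝ) (H : J → Set (ℝ × ℝ)) (M : ℝ) : Prop where
  hab : ∀ i, a i < b i
  hcd : ∀ i, c i < d i
  la : ∀ i, -M ≤ a i
  bM : ∀ i, b i ≤ M
  lc : ∀ i, -M ≤ c i
  dM : ∀ i, d i ≤ M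
  sep : ∀ i j, i ≠ j → b i ≤ a j ∨ b j ≤ a i ∨ d i ≤ c j ∨ d j ≤ c i
  op : ∀ j, IsOpen (H j)
  ne : ∀ j, (H j).Nonempty
  bdd : ∀ j, H j ⊆ Icc (-M) M ×ˢ Icc (-M) M
  fr : ∀ j, ∀ p ∈ frontier (H j), ∃ i, a i ≤ p.1 ∧ p.1 ≤ b i ∧ c i ≤ p.2 ∧ p.2 ≤ d i
  dis : ∀ j, ∀ p ∈ H j, ∀ i, ¬ (a i ≤ p.1 ∧ p.1 ≤ b i ∧ c i ≤ p.2 ∧ p.2 ≤ d i)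
  pd : ∀ j j', ∀ p ∈ H j, p ∈ H j' → j = j'

section
variable {ι J : Type*} {a b c d : ι → ℝ} {H : J → Set (ℝ × ℝ)} {M : ℝ}

theorem HoleSys.neg (h : HoleSys a b c d H M) :
    HoleSys (fun i => - b i) (fun i => - a i) (fun i => - d i) (fun i => - c i)
      (fun j => (fun p => -p) ⁻¹' (H j)) M where
  hab i := by have := h.hab i; simpa
  hcd i := by have := h.hcd i; simpa
  la i := by have := h.bM i; simpa
  bM i := by have := h.la i; linarith
  lc i := by have := h.dM i; simpa
  dM i := by have := h.lc i; linarith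
  sep i j hij := by
    have := h.sep i j hij
    simp only [neg_le_neg_iff]; tauto
  op j := (h.op j).preimage continuous_neg
  ne j := by
    obtain ⟨p, hp⟩ := h.ne j
    exact ⟨-p, by simpa using hp⟩
  bdd j p hp := by
    have := h.bdd j hp
    simp only [mem_prod, mem_Icc, Prod.fst_neg, Prod.snd_neg] at this ⊢
    refine ⟨⟨?_, ?_⟩, ?_, ?_⟩ <;> linarith [this.1.1, this.1.2, this.2.1, this.2.2]
  fr j p hp := by
    have h1 : -p ∈ frontier (H j) := by
      have := (Homeomorph.neg (ℝ × ℝ)).preimage_frontier (H j)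
      have h2 : p ∈ (Homeomorph.neg (ℝ × ℝ)) ⁻¹' frontier (H j) := by
        rw [this]; exact hp
      exact h2
    obtain ⟨i, h1, h2, h3, h4⟩ := h.fr j _ h1
    simp only [Prod.fst_neg, Prod.snd_neg] at h1 h2 h3 h4
    exact ⟨i, by linarith, by linarith, by linarith, by linarith⟩
  dis j p hp i hi := by
    refine h.dis j _ hp i ?_
    obtain ⟨h1, h2, h3, h4⟩ := hi
    simp only [Prod.fst_neg, Prod.snd_neg]
    exact ⟨by linarith, by linarith, by linarith, by linarith⟩
  pd j j' p hp hp' := h.pd j j' _ hp hp'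

theorem HoleSys.swap (h : HoleSys a b c d H M) :
    HoleSys c d a b (fun j => Prod.swap ⁻¹' (H j)) M where
  hab := h.hcd
  hcd := h.hab
  la := h.lc
  bM := h.dM
  lc := h.la
  dM := h.bM
  sep i j hij := by have := h.sep i j hij; tauto
  op j := (h.op j).preimage continuous_swap
  ne j := by
    obtain ⟨p, hp⟩ := h.ne j
    exact ⟨p.swap, by simpa using hp⟩
  bdd j p hp := by
    have := h.bdd j hp
    exact ⟨this.2, this.1⟩
  fr j p hp := by
    have h1 : p.swap ∈ frontier (H j) := by
      have := (Homeomorph.prodComm ℝ ℝ).preimage_frontier (H j)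
      have h2 : p ∈ (Homeomorph.prodComm ℝ ℝ) ⁻¹' frontier (H j) := by
        rw [this]; exact hp
      exact h2
    obtain ⟨i, h1, h2, h3, h4⟩ := h.fr j _ h1
    exact ⟨i, h3, h4, h1, h2⟩
  dis j p hp i hi := by
    refine h.dis j _ hp i ?_
    obtain ⟨h1, h2, h3, h4⟩ := hi
    exact ⟨h3, h4, h1, h2⟩
  pd j j' p hp hp' := h.pd j j' _ hp hp'

/-- If no rectangle lies above `i`, then no hole meets the strip above `i`. -/
theorem HoleSys.above (h : HoleSys a b c d H M) (i : ι)
    (hi : ¬ ∃ j, d i ≤ c j ∧ a j < b i ∧ a i < b j) (j : J) (p : ℝ × ℝ) (hp : p ∈ H j)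
    (h1 : a i ≤ p.1) (h2 : p.1 ≤ b i) (h3 : c i ≤ p.2) : False := by
  have h4 : d i < p.2 := by
    by_contra! hcon
    exact h.dis j p hp i ⟨h1, h2, h3, hcon⟩
  have hab := h.hab i
  have hcd := h.hcd i
  -- move to the open strip
  obtain ⟨x, hx1, hx2, hx⟩ : ∃ x, a i < x ∧ x < b i ∧ (x, p.2) ∈ H j := by
    have hop : IsOpen ((fun x : ℝ => (x, p.2)) ⁻¹' (H j)) := (h.op j).preimage (by fun_prop)
    have hcl : p.1 ∈ closure (Ioo (a i) (b i)) := by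
      rw [closure_Ioo hab.ne]; exact ⟨h1, h2⟩
    obtain ⟨x, hx, hx'⟩ := mem_closure_iff.1 hcl _ hop hp
    exact ⟨x, hx'.1, hx'.2, hx⟩
  have hsub : (fun y : ℝ => (x, y)) '' (Ici p.2) ⊆ H j := by
    refine subset_of_frontier_disjoint ?_ (h.op j) ⟨(x, p.2), ⟨p.2, by simp, rfl⟩, hx⟩ ?_
    · exact isPreconnected_Ici.image _ (by fun_prop)
    · rintro _ ⟨y, hy, rfl⟩ hf
      obtain ⟨k, k1, k2, k3, k4⟩ := h.fr j _ hf
      simp only [mem_Ici] at *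
      have hki : k ≠ i := by rintro rfl; linarith
      rcases h.sep i k hki.symm with q | q | q | q
      · linarith
      · linarith
      · exact hi ⟨k, q, by linarith, by linarith⟩
      · linarith
  have hbig : (x, max p.2 (M + 1)) ∈ H j := hsub ⟨_, by simp, rfl⟩
  have := (h.bdd j hbig).2.2
  have := le_max_right p.2 (M + 1)
  simp only at *
  linarith

theorem HoleSys.below (h : HoleSys a b c d H M) (i : ι)
    (hi : ¬ ∃ j, d j ≤ c i ∧ a j < b i ∧ a i < b j) (j : J) (p : ℝ × ℝ) (hp : p ∈ H j)
    (h1 : a i ≤ p.1) (h2 : p.1 ≤ b i) (h3 : p.2 ≤ d i) : False := by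
  refine h.neg.above i ?_ j (-p) (by simpa using hp) ?_ ?_ ?_
  · rintro ⟨k, k1, k2, k3⟩
    exact hi ⟨k, by linarith, by linarith, by linarith⟩
  all_goals simpa

theorem HoleSys.toRight (h : HoleSys a b c d H M) (i : ι)
    (hi : ¬ ∃ j, b i ≤ a j ∧ c j < d i ∧ c i < d j) (j : J) (p : ℝ × ℝ) (hp : p ∈ H j)
    (h1 : c i ≤ p.2) (h2 : p.2 ≤ d i) (h3 : a i ≤ p.1) : False :=
  h.swap.above i hi j p.swap (by simpa using hp) h1 h2 h3

theorem HoleSys.toLeft (h : HoleSys a b c d H M) (i : ι)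
    (hi : ¬ ∃ j, b j ≤ a i ∧ c j < d i ∧ c i < d j) (j : J) (p : ℝ × ℝ) (hp : p ∈ H j)
    (h1 : c i ≤ p.2) (h2 : p.2 ≤ d i) (h3 : p.1 ≤ b i) : False :=
  h.swap.below i hi j p.swap (by simpa using hp) h1 h2 h3

/-- A cell not crossed by any side is inside a hole as soon as it meets it. -/
theorem HoleSys.cell (h : HoleSys a b c d H M) (j : J) {x1 x2 y1 y2 : ℝ}
    (ha : ∀ k, a k ∉ Ioo x1 x2) (hb : ∀ k, b k ∉ Ioo x1 x2)
    (hc : ∀ k, c k ∉ Ioo y1 y2) (hd : ∀ k, d k ∉ Ioo y1 y2)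
    {p : ℝ × ℝ} (hp : p ∈ H j) (hpc : p ∈ Ioo x1 x2 ×ˢ Ioo y1 y2) :
    Ioo x1 x2 ×ˢ Ioo y1 y2 ⊆ H j := by
  refine subset_of_frontier_disjoint (isPreconnected_Ioo.prod isPreconnected_Ioo) (h.op j)
    ⟨p, hpc, hp⟩ ?_
  rintro q ⟨⟨q1, q2⟩, q3, q4⟩ hf
  obtain ⟨k, k1, k2, k3, k4⟩ := h.fr j q hf
  obtain ⟨⟨p1, p2⟩, p3, p4⟩ := hpc
  have ha := ha k
  have hb := hb k
  have hc := hc k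
  have hd := hd k
  simp only [mem_Ioo, not_and_or, not_lt] at ha hb hc hd
  refine h.dis j p hp k ⟨?_, ?_, ?_, ?_⟩
  · rcases ha with q | q <;> linarith
  · rcases hb with q | q <;> linarith
  · rcases hc with q | q <;> linarith
  · rcases hd with q | q <;> linarith

theorem exists_gap [Finite ι] (f : ι → ℝ) (x : ℝ) :
    ∃ ε > 0, ∀ k, f k ∉ Ioo (x - ε) x ∧ f k ∉ Ioo x (x + ε) := by
  have hfin : ({x}ᶜ ∩ range f).Finite := (finite_range f).subset inter_subset_right
  have hop : IsOpen ({x}ᶜ ∩ range f)ᶜ := hfin.isClosed.isOpen_compl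
  obtain ⟨ε, hε, hb⟩ := Metric.isOpen_iff.1 hop x (by simp)
  refine ⟨ε, hε, fun k => ⟨fun hk => ?_, fun hk => ?_⟩⟩
  · refine hb (a := f k) ?_ ⟨?_, mem_range_self k⟩
    · rw [Metric.mem_ball, Real.dist_eq, abs_lt]; constructor <;> linarith [hk.1, hk.2]
    · exact ne_of_lt hk.2
  · refine hb (a := f k) ?_ ⟨?_, mem_range_self k⟩
    · rw [Metric.mem_ball, Real.dist_eq, abs_lt]; constructor <;> linarith [hk.1, hk.2]
    · exact ne_of_gt hk.1

/-- Every hole has a lower-left corner. -/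
theorem HoleSys.corner [Finite ι] (h : HoleSys a b c d H M) (j : J) :
    ∃ x y ε : ℝ, 0 < ε ∧ Ioo x (x + ε) ×ˢ Ioo y (y + ε) ⊆ H j ∧
      (∃ A, b A = x ∧ c A ≤ y ∧ y < d A) ∧ (∃ B, d B = y ∧ a B ≤ x ∧ x < b B) := by
  have hcomp : IsCompact (closure (H j)) := by
    refine ((isCompact_Icc (a := -M) (b := M)).prod (isCompact_Icc (a := -M) (b := M))).of_isClosed_subset
      isClosed_closure ?_
    exact closure_minimal (h.bdd j) (isClosed_Icc.prod isClosed_Icc)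
  obtain ⟨p0, hp0, hmin0⟩ := hcomp.exists_isMinOn (h.ne j).closure continuous_fst.continuousOn
  have hcomp2 : IsCompact (closure (H j) ∩ {p | p.1 = p0.1}) :=
    hcomp.inter_right (isClosed_eq continuous_fst continuous_const)
  obtain ⟨p, ⟨hp, hpx⟩, hmin⟩ := hcomp2.exists_isMinOn ⟨p0, hp0, rfl⟩ continuous_snd.continuousOn
  obtain ⟨x, y⟩ := p
  simp only [mem_ofPred_eq] at hpx
  have hx : ∀ q ∈ closure (H j), x ≤ q.1 := fun q hq => by
    have := hmin0 hq
    simp only [mem_ofPred_eq] at this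
    linarith
  have hy : ∀ y', (x, y') ∈ closure (H j) → y ≤ y' := fun y' hq => by
    have := hmin ⟨hq, hpx⟩
    simpa using this
  clear hmin hmin0 hp0 hcomp2
  obtain ⟨e1, he1, g1⟩ := exists_gap a x
  obtain ⟨e2, he2, g2⟩ := exists_gap b x
  obtain ⟨e3, he3, g3⟩ := exists_gap c y
  obtain ⟨e4, he4, g4⟩ := exists_gap d y
  obtain ⟨ε, hε, l1, l2, l3, l4⟩ : ∃ ε > 0, ε ≤ e1 ∧ ε ≤ e2 ∧ ε ≤ e3 ∧ ε ≤ e4 :=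
    ⟨min (min e1 e2) (min e3 e4), by positivity, by simp, by simp, by simp, by simp⟩
  have a1 : ∀ k, a k ∉ Ioo x (x + ε) := fun k hk => (g1 k).2 ⟨hk.1, by linarith [hk.2]⟩
  have b1 : ∀ k, b k ∉ Ioo x (x + ε) := fun k hk => (g2 k).2 ⟨hk.1, by linarith [hk.2]⟩
  have c1 : ∀ k, c k ∉ Ioo y (y + ε) := fun k hk => (g3 k).2 ⟨hk.1, by linarith [hk.2]⟩
  have d1 : ∀ k, d k ∉ Ioo y (y + ε) := fun k hk => (g4 k).2 ⟨hk.1, by linarith [hk.2]⟩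
  have c0 : ∀ k, c k ∉ Ioo (y - ε) y := fun k hk => (g3 k).1 ⟨by linarith [hk.1], hk.2⟩
  have d0 : ∀ k, d k ∉ Ioo (y - ε) y := fun k hk => (g4 k).1 ⟨by linarith [hk.1], hk.2⟩
  clear g1 g2 g3 g4
  -- the lower right quadrant avoids the hole
  have hLR : ∀ q ∈ H j, q ∉ Ioo x (x + ε) ×ˢ Ioo (y - ε) y := by
    intro q hq hq'
    have hs := h.cell j a1 b1 c0 d0 hq hq'
    have : (x, y - ε / 2) ∈ closure (H j) := by
      refine closure_mono hs ?_
      rw [closure_prod_eq, closure_Ioo (by linarith), closure_Ioo (by linarith)]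
      exact ⟨⟨le_rfl, by simp only; linarith⟩, by simp only; linarith, by simp only; linarith⟩
    linarith [hy _ this]
  -- points of the hole to the right of `x` at height `y` do not exist
  have hmid : ∀ x' ∈ Ioo x (x + ε), (x', y) ∉ H j := by
    intro x' hx' hm
    have hop : IsOpen ((fun y' : ℝ => (x', y')) ⁻¹' (H j)) := (h.op j).preimage (by fun_prop)
    have hcl : y ∈ closure (Ioo (y - ε) y) := by
      rw [closure_Ioo (by linarith)]; exact ⟨by linarith, le_rfl⟩
    obtain ⟨y', h1, h2⟩ := mem_closure_iff.1 hcl _ hop hm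
    exact hLR _ h1 ⟨hx', h2⟩
  have hxlt : ∀ q ∈ H j, x < q.1 := by
    intro q hq
    have hop : IsOpen ((fun x' : ℝ => (x', q.2)) ⁻¹' (H j)) := (h.op j).preimage (by fun_prop)
    have hcl : q.1 ∈ closure (Iio q.1) := by
      rw [closure_Iio]; exact le_refl q.1
    obtain ⟨x', h1, h2⟩ := mem_closure_iff.1 hcl _ hop hq
    have := hx _ (subset_closure h1)
    simp only [mem_Iio] at *
    linarith
  have hUR : Ioo x (x + ε) ×ˢ Ioo y (y + ε) ⊆ H j := by
    obtain ⟨q, ⟨⟨q1, q2⟩, q3, q4⟩, hq⟩ := mem_closure_iff.1 hp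
      (Ioo (x - ε) (x + ε) ×ˢ Ioo (y - ε) (y + ε)) (isOpen_Ioo.prod isOpen_Ioo)
      ⟨⟨by simp only; linarith, by simp only; linarith⟩, by simp only; linarith, by simp only; linarith⟩
    have q5 := hxlt q hq
    rcases lt_trichotomy q.2 y with q6 | q6 | q6
    · exact absurd ⟨⟨q5, q2⟩, q3, q6⟩ (hLR q hq)
    · exact absurd (by rw [← q6]; exact hq) (hmid q.1 ⟨q5, q2⟩)
    · exact h.cell j a1 b1 c1 d1 hq ⟨⟨q5, q2⟩, q6, q4⟩
  have hclo : Icc x (x + ε) ×ˢ Icc y (y + ε) ⊆ closure (H j) := by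
    have := closure_mono hUR
    rwa [closure_prod_eq, closure_Ioo (by linarith), closure_Ioo (by linarith)] at this
  have hmem : (x + ε / 2, y + ε / 2) ∈ H j :=
    hUR ⟨⟨by simp only; linarith, by simp only; linarith⟩, by simp only; linarith, by simp only; linarith⟩
  refine ⟨x, y, ε, hε, hUR, ?_, ?_⟩
  · have hfr : (x, y + ε / 2) ∈ frontier (H j) := by
      refine ⟨hclo ⟨⟨by simp only; linarith, by simp only; linarith⟩, by simp only; linarith, by simp only; linarith⟩, ?_⟩
      rw [(h.op j).interior_eq]
      intro hm
      exact lt_irrefl _ (hxlt _ hm)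
    obtain ⟨k, k1, k2, k3, k4⟩ := h.fr j _ hfr
    simp only at k1 k2 k3 k4
    have hc := c1 k
    have hd := d1 k
    have hb := b1 k
    have hdis := h.dis j _ hmem k
    simp only [mem_Ioo, not_and_or, not_lt] at hc hd hb
    simp only at hdis
    have r1 : c k ≤ y := by rcases hc with q | q <;> linarith
    have r2 : y + ε ≤ d k := by rcases hd with q | q <;> linarith
    refine ⟨k, ?_, r1, by linarith⟩
    rcases hb with q | q
    · linarith
    · exact absurd ⟨by linarith, by linarith, by linarith, by linarith⟩ hdis
  · have hfr : (x + ε / 2, y) ∈ frontier (H j) := by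
      refine ⟨hclo ⟨⟨by simp only; linarith, by simp only; linarith⟩, by simp only; linarith, by simp only; linarith⟩, ?_⟩
      rw [(h.op j).interior_eq]
      exact hmid _ ⟨by linarith, by linarith⟩
    obtain ⟨k, k1, k2, k3, k4⟩ := h.fr j _ hfr
    simp only at k1 k2 k3 k4
    have ha := a1 k
    have hd := d1 k
    have hb := b1 k
    have hdis := h.dis j _ hmem k
    simp only [mem_Ioo, not_and_or, not_lt] at ha hd hb
    simp only at hdis
    have r1 : a k ≤ x := by rcases ha with q | q <;> linarith
    have r2 : x + ε ≤ b k := by rcases hb with q | q <;> linarith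
    refine ⟨k, ?_, r1, by linarith⟩
    rcases hd with q | q
    · linarith
    · exact absurd ⟨by linarith, by linarith, by linarith, by linarith⟩ hdis

/-- Corners used by holes: `(j, true)` is the lower-left corner of hole `j`, `(j, false)` its
upper-right one; `(k, true)` is the upper-left corner of rectangle `k`, `(k, false)` its
lower-right one. -/
def CornerUse (a b c d : ι → ℝ) (H : J → Set (ℝ × ℝ)) : J × Bool → ι × Bool → Prop
  | (j, true), (k, true) =>
      (∃ ε > 0, Ioo (a k) (a k + ε) ×ˢ Ioo (d k) (d k + ε) ⊆ H j) ∧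
        ∃ A, b A = a k ∧ d k < d A
  | (j, true), (k, false) =>
      (∃ ε > 0, Ioo (b k) (b k + ε) ×ˢ Ioo (c k) (c k + ε) ⊆ H j) ∧
        ∃ B, d B = c k ∧ a B < b k ∧ b k < b B
  | (j, false), (k, false) =>
      (∃ ε > 0, Ioo (b k - ε) (b k) ×ˢ Ioo (c k - ε) (c k) ⊆ H j) ∧
        ∃ A, a A = b k ∧ c A < c k
  | (j, false), (k, true) =>
      (∃ ε > 0, Ioo (a k - ε) (a k) ×ˢ Ioo (d k - ε) (d k) ⊆ H j) ∧
        ∃ B, c B = d k ∧ a B < a k ∧ a k < b B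

theorem HoleSys.exists_use_true [Finite ι] (h : HoleSys a b c d H M) (j : J) :
    (∃ k, CornerUse a b c d H (j, true) (k, true)) ∨
      ∃ k, CornerUse a b c d H (j, true) (k, false) := by
  obtain ⟨x, y, ε, hε, hs, ⟨A, A1, A2, A3⟩, ⟨B, B1, B2, B3⟩⟩ := h.corner j
  have hAB : A ≠ B := by rintro rfl; linarith
  rcases B2.lt_or_eq with hB | hB
  · right
    have hc : c A = y := by
      rcases h.sep A B hAB with q | q | q | q
      · linarith
      · linarith [h.hab A]
      · linarith [h.hcd B]
      · linarith
    exact ⟨A, ⟨ε, hε, by rw [A1, hc]; exact hs⟩, B, by linarith, by linarith, by linarith⟩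
  · left
    exact ⟨B, ⟨ε, hε, by rw [B1, hB]; exact hs⟩, A, by linarith, by linarith⟩

theorem HoleSys.exists_use_false [Finite ι] (h : HoleSys a b c d H M) (j : J) :
    (∃ k, CornerUse a b c d H (j, false) (k, true)) ∨
      ∃ k, CornerUse a b c d H (j, false) (k, false) := by
  rcases h.neg.exists_use_true j with ⟨k, ⟨ε, hε, hs⟩, A, A1, A2⟩ | ⟨k, ⟨ε, hε, hs⟩, B, B1, B2, B3⟩
  · right
    refine ⟨k, ⟨ε, hε, ?_⟩, A, by linarith, by linarith⟩
    rintro ⟨p1, p2⟩ ⟨⟨q1, q2⟩, q3, q4⟩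
    simp only at q1 q2 q3 q4
    have : (-p1, -p2) ∈ (fun p : ℝ × ℝ => -p) ⁻¹' H j :=
      hs ⟨⟨by simp only; linarith, by simp only; linarith⟩, by simp only; linarith, by simp only; linarith⟩
    simpa using this
  · left
    refine ⟨k, ⟨ε, hε, ?_⟩, B, by linarith, by linarith, by linarith⟩
    rintro ⟨p1, p2⟩ ⟨⟨q1, q2⟩, q3, q4⟩
    simp only at q1 q2 q3 q4
    have : (-p1, -p2) ∈ (fun p : ℝ × ℝ => -p) ⁻¹' H j :=
      hs ⟨⟨by simp only; linarith, by simp only; linarith⟩, by simp only; linarith, by simp only; linarith⟩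
    simpa using this

theorem HoleSys.exists_use [Finite ι] (h : HoleSys a b c d H M) (u : J × Bool) :
    ∃ v, CornerUse a b c d H u v := by
  obtain ⟨j, _ | _⟩ := u
  · rcases h.exists_use_false j with ⟨k, hk⟩ | ⟨k, hk⟩
    exacts [⟨_, hk⟩, ⟨_, hk⟩]
  · rcases h.exists_use_true j with ⟨k, hk⟩ | ⟨k, hk⟩
    exacts [⟨_, hk⟩, ⟨_, hk⟩]

theorem germ_pos {x y e f : ℝ} (he : 0 < e) (hf : 0 < f) {S T : Set (ℝ × ℝ)}
    (hS : Ioo x (x + e) ×ˢ Ioo y (y + e) ⊆ S) (hT : Ioo x (x + f) ×ˢ Ioo y (y + f) ⊆ T) :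
    ∃ p, p ∈ S ∧ p ∈ T := by
  have hg : 0 < min e f := lt_min he hf
  have h1 := min_le_left e f
  have h2 := min_le_right e f
  refine ⟨(x + min e f / 2, y + min e f / 2), hS ⟨⟨?_, ?_⟩, ?_, ?_⟩, hT ⟨⟨?_, ?_⟩, ?_, ?_⟩⟩ <;>
    simp only <;> linarith

theorem germ_neg {x y e f : ℝ} (he : 0 < e) (hf : 0 < f) {S T : Set (ℝ × ℝ)}
    (hS : Ioo (x - e) x ×ˢ Ioo (y - e) y ⊆ S) (hT : Ioo (x - f) x ×ˢ Ioo (y - f) y ⊆ T) :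
    ∃ p, p ∈ S ∧ p ∈ T := by
  have hg : 0 < min e f := lt_min he hf
  have h1 := min_le_left e f
  have h2 := min_le_right e f
  refine ⟨(x - min e f / 2, y - min e f / 2), hS ⟨⟨?_, ?_⟩, ?_, ?_⟩, hT ⟨⟨?_, ?_⟩, ?_, ?_⟩⟩ <;>
    simp only <;> linarith

theorem HoleSys.use_ne_true (h : HoleSys a b c d H M) {j j' : J} {k : ι}
    (h1 : CornerUse a b c d H (j, true) (k, true))
    (h2 : CornerUse a b c d H (j', false) (k, true)) : False := by
  obtain ⟨⟨e, he, hs⟩, -⟩ := h1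
  obtain ⟨-, B, B1, B2, B3⟩ := h2
  have hcd := h.hcd B
  obtain ⟨f, hf, f1, f2⟩ : ∃ f > 0, a k + f ≤ b B ∧ d k + f ≤ d B :=
    ⟨min (b B - a k) (d B - d k), lt_min (by linarith) (by linarith),
      by linarith [min_le_left (b B - a k) (d B - d k)],
      by linarith [min_le_right (b B - a k) (d B - d k)]⟩
  obtain ⟨p, hp, ⟨p1, p2⟩, p3, p4⟩ := germ_pos he hf hs subset_rfl
  exact h.dis j p hp B ⟨by linarith, by linarith, by linarith, by linarith⟩

theorem HoleSys.use_ne_false (h : HoleSys a b c d H M) {j j' : J} {k : ι}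
    (h1 : CornerUse a b c d H (j, true) (k, false))
    (h2 : CornerUse a b c d H (j', false) (k, false)) : False := by
  obtain ⟨⟨e, he, hs⟩, -⟩ := h2
  obtain ⟨-, B, B1, B2, B3⟩ := h1
  have hcd := h.hcd B
  obtain ⟨f, hf, f1, f2⟩ : ∃ f > 0, a B ≤ b k - f ∧ c B ≤ c k - f :=
    ⟨min (b k - a B) (c k - c B), lt_min (by linarith) (by linarith),
      by linarith [min_le_left (b k - a B) (c k - c B)],
      by linarith [min_le_right (b k - a B) (c k - c B)]⟩
  obtain ⟨p, hp, ⟨p1, p2⟩, p3, p4⟩ := germ_neg he hf hs subset_rfl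
  exact h.dis j' p hp B ⟨by linarith, by linarith, by linarith, by linarith⟩

theorem HoleSys.use_inj (h : HoleSys a b c d H M) {u u' : J × Bool} {v : ι × Bool}
    (h1 : CornerUse a b c d H u v) (h2 : CornerUse a b c d H u' v) : u = u' := by
  obtain ⟨j, s⟩ := u
  obtain ⟨j', s'⟩ := u'
  obtain ⟨k, t⟩ := v
  cases s <;> cases s' <;> cases t
  · obtain ⟨⟨e, he, hs⟩, -⟩ := h1
    obtain ⟨⟨e', he', hs'⟩, -⟩ := h2
    obtain ⟨p, hp, hp'⟩ := germ_neg he he' hs hs'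
    rw [h.pd j j' p hp hp']
  · obtain ⟨⟨e, he, hs⟩, -⟩ := h1
    obtain ⟨⟨e', he', hs'⟩, -⟩ := h2
    obtain ⟨p, hp, hp'⟩ := germ_neg he he' hs hs'
    rw [h.pd j j' p hp hp']
  · exact (h.use_ne_false h2 h1).elim
  · exact (h.use_ne_true h2 h1).elim
  · exact (h.use_ne_false h1 h2).elim
  · exact (h.use_ne_true h1 h2).elim
  · obtain ⟨⟨e, he, hs⟩, -⟩ := h1
    obtain ⟨⟨e', he', hs'⟩, -⟩ := h2
    obtain ⟨p, hp, hp'⟩ := germ_pos he he' hs hs'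
    rw [h.pd j j' p hp hp']
  · obtain ⟨⟨e, he, hs⟩, -⟩ := h1
    obtain ⟨⟨e', he', hs'⟩, -⟩ := h2
    obtain ⟨p, hp, hp'⟩ := germ_pos he he' hs hs'
    rw [h.pd j j' p hp hp']

theorem HoleSys.use_true (h : HoleSys a b c d H M) {u : J × Bool} {k : ι}
    (h1 : CornerUse a b c d H u (k, true)) : ¬ (d k = M ∨ a k = -M) := by
  obtain ⟨j, s⟩ := u
  cases s
  · obtain ⟨-, B, B1, B2, B3⟩ := h1
    have := h.hcd B
    have := h.dM B
    have := h.la B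
    rintro (q | q) <;> linarith
  · obtain ⟨-, B, B1, B2⟩ := h1
    have := h.hab B
    have := h.dM B
    have := h.la B
    rintro (q | q) <;> linarith

theorem HoleSys.use_false (h : HoleSys a b c d H M) {u : J × Bool} {k : ι}
    (h1 : CornerUse a b c d H u (k, false)) : ¬ (c k = -M ∨ b k = M) := by
  obtain ⟨j, s⟩ := u
  cases s
  · obtain ⟨-, B, B1, B2⟩ := h1
    have := h.hab B
    have := h.lc B
    have := h.bM B
    rintro (q | q) <;> linarith
  · obtain ⟨-, B, B1, B2, B3⟩ := h1
    have := h.hcd B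
    have := h.lc B
    have := h.bM B
    rintro (q | q) <;> linarith

open Classical in
theorem HoleSys.count [Fintype ι] [Fintype J] (h : HoleSys a b c d H M) :
    2 * Fintype.card J + ((Finset.univ.filter (fun i => d i = M ∨ a i = -M)).card
      + (Finset.univ.filter (fun i => c i = -M ∨ b i = M)).card) ≤ 2 * Fintype.card ι := by
  choose f hf using h.exists_use
  have hinj : Function.Injective f := by
    intro u u' huu
    exact h.use_inj (hf u) (huu ▸ hf u')
  set T := Finset.univ.filter (fun i => d i = M ∨ a i = -M)
  set B := Finset.univ.filter (fun i => c i = -M ∨ b i = M)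
  set X : Finset (ι × Bool) := Finset.univ.image f
  set Y : Finset (ι × Bool) := T.image (fun i => (i, true))
  set W : Finset (ι × Bool) := B.image (fun i => (i, false))
  have cX : X.card = 2 * Fintype.card J := by
    rw [Finset.card_image_of_injective _ hinj, Finset.card_univ, Fintype.card_prod,
      Fintype.card_bool, mul_comm]
  have cY : Y.card = T.card := Finset.card_image_of_injective _ (fun x y hxy => by simpa using hxy)
  have cW : W.card = B.card := Finset.card_image_of_injective _ (fun x y hxy => by simpa using hxy)
  have dYW : Disjoint Y W := by
    rw [Finset.disjoint_left]
    intro v hv hv'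
    simp only [Y, W, Finset.mem_image] at hv hv'
    obtain ⟨i, -, rfl⟩ := hv
    obtain ⟨i', -, hi'⟩ := hv'
    simp at hi'
  have dX : Disjoint X (Y ∪ W) := by
    rw [Finset.disjoint_left]
    intro v hv hv'
    simp only [X, Finset.mem_image, Finset.mem_univ, true_and] at hv
    obtain ⟨u, rfl⟩ := hv
    have hu := hf u
    rcases Finset.mem_union.1 hv' with hv | hv
    · obtain ⟨i, hi, hi'⟩ := Finset.mem_image.1 hv
      rw [← hi'] at hu
      exact h.use_true hu (Finset.mem_filter.1 hi).2
    · obtain ⟨i, hi, hi'⟩ := Finset.mem_image.1 hv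
      rw [← hi'] at hu
      exact h.use_false hu (Finset.mem_filter.1 hi).2
  have := Finset.card_le_univ (X ∪ (Y ∪ W))
  rw [Finset.card_union_of_disjoint dX, Finset.card_union_of_disjoint dYW, Fintype.card_prod,
    Fintype.card_bool] at this
  omega
end

section
variable {ι J : Type*} {a b c d : ι → ℝ} {H : J → Set (ℝ × ℝ)} {M : ℝ}

open Classical in
theorem HoleSys.growUp (h : HoleSys a b c d H M) (i : ι)
    (hi : ¬ ∃ j, d i ≤ c j ∧ a j < b i ∧ a i < b j) :
    HoleSys a b c (Function.update d i M) H M := by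
  have hle : ∀ k, d k ≤ Function.update d i M k := by
    intro k
    by_cases hk : k = i
    · subst hk; simpa using h.dM k
    · simp [hk]
  refine { h with hcd := ?_, dM := ?_, sep := ?_, fr := ?_, dis := ?_ }
  · exact fun k => (h.hcd k).trans_le (hle k)
  · intro k
    by_cases hk : k = i
    · subst hk; simp
    · simpa [hk] using h.dM k
  · intro k l hkl
    have hs := h.sep k l hkl
    by_cases hk : k = i
    · subst hk
      rw [Function.update_of_ne hkl.symm]
      rcases hs with q | q | q | q
      · exact Or.inl q
      · exact Or.inr (Or.inl q)
      · by_contra! hcon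
        exact hi ⟨l, q, hcon.1, hcon.2.1⟩
      · exact Or.inr (Or.inr (Or.inr q))
    · rw [Function.update_of_ne hk]
      by_cases hl : l = i
      · subst hl
        rcases hs with q | q | q | q
        · exact Or.inl q
        · exact Or.inr (Or.inl q)
        · exact Or.inr (Or.inr (Or.inl q))
        · by_contra! hcon
          exact hi ⟨k, q, hcon.2.1, hcon.1⟩
      · rwa [Function.update_of_ne hl]
  · intro j p hp
    obtain ⟨k, k1, k2, k3, k4⟩ := h.fr j p hp
    exact ⟨k, k1, k2, k3, k4.trans (hle k)⟩
  · intro j p hp k hk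
    by_cases hki : k = i
    · subst hki
      exact h.above k hi j p hp hk.1 hk.2.1 hk.2.2.1
    · rw [Function.update_of_ne hki] at hk
      exact h.dis j p hp k hk

open Classical in
theorem HoleSys.growDown (h : HoleSys a b c d H M) (i : ι)
    (hi : ¬ ∃ j, d j ≤ c i ∧ a j < b i ∧ a i < b j) :
    HoleSys a b (Function.update c i (-M)) d H M := by
  have hle : ∀ k, Function.update c i (-M) k ≤ c k := by
    intro k
    by_cases hk : k = i
    · subst hk; simpa using h.lc k
    · simp [hk]
  refine { h with hcd := ?_, lc := ?_, sep := ?_, fr := ?_, dis := ?_ }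
  · exact fun k => (hle k).trans_lt (h.hcd k)
  · intro k
    by_cases hk : k = i
    · subst hk; simp
    · simpa [hk] using h.lc k
  · intro k l hkl
    have hs := h.sep k l hkl
    by_cases hk : k = i
    · subst hk
      rw [Function.update_of_ne hkl.symm]
      rcases hs with q | q | q | q
      · exact Or.inl q
      · exact Or.inr (Or.inl q)
      · exact Or.inr (Or.inr (Or.inl q))
      · by_contra! hcon
        exact hi ⟨l, q, hcon.1, hcon.2.1⟩
    · rw [Function.update_of_ne hk]
      by_cases hl : l = i
      · subst hl
        rcases hs with q | q | q | q
        · exact Or.inl q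
        · exact Or.inr (Or.inl q)
        · by_contra! hcon
          exact hi ⟨k, q, hcon.2.1, hcon.1⟩
        · exact Or.inr (Or.inr (Or.inr q))
      · rwa [Function.update_of_ne hl]
  · intro j p hp
    obtain ⟨k, k1, k2, k3, k4⟩ := h.fr j p hp
    exact ⟨k, k1, k2, (hle k).trans k3, k4⟩
  · intro j p hp k hk
    by_cases hki : k = i
    · subst hki
      exact h.below k hi j p hp hk.1 hk.2.1 hk.2.2.2
    · rw [Function.update_of_ne hki] at hk
      exact h.dis j p hp k hk

open Classical in
theorem HoleSys.growRight (h : HoleSys a b c d H M) (i : ι)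
    (hi : ¬ ∃ j, b i ≤ a j ∧ c j < d i ∧ c i < d j) :
    HoleSys a (Function.update b i M) c d H M :=
  (h.swap.growUp i hi).swap

open Classical in
theorem HoleSys.growLeft (h : HoleSys a b c d H M) (i : ι)
    (hi : ¬ ∃ j, b j ≤ a i ∧ c j < d i ∧ c i < d j) :
    HoleSys (Function.update a i (-M)) b c d H M :=
  (h.swap.growDown i hi).swap

open Classical in
theorem sum_update_lt [Fintype ι] (f : ι → ℝ) (i : ι) (v : ℝ) (hv : f i < v) :
    ∑ k, f k < ∑ k, Function.update f i v k := by
  refine Finset.sum_lt_sum (fun k _ => ?_) ⟨i, Finset.mem_univ _, by simpa⟩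
  by_cases hk : k = i
  · subst hk; simpa using hv.le
  · simp [hk]

open Classical in
theorem sum_update_gt [Fintype ι] (f : ι → ℝ) (i : ι) (v : ℝ) (hv : v < f i) :
    ∑ k, Function.update f i v k < ∑ k, f k := by
  refine Finset.sum_lt_sum (fun k _ => ?_) ⟨i, Finset.mem_univ _, by simpa⟩
  by_cases hk : k = i
  · subst hk; simpa using hv.le
  · simp [hk]

theorem HoleSys.exists_ext [Fintype ι] (h : HoleSys a b c d H M) :
    ∃ a' b' c' d' : ι → ℝ, HoleSys a' b' c' d' H M ∧ ExtFam a' b' c' d' M := by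
  classical
  set S : Set ℝ := range a ∪ range b ∪ range c ∪ range d ∪ {M, -M} with hS
  have hSf : S.Finite := by
    refine ((((finite_range a).union (finite_range b)).union (finite_range c)).union
      (finite_range d)).union (by simp)
  have hM : M ∈ S := by simp [hS]
  have hM' : -M ∈ S := by simp [hS]
  set P : Set (ι → ℝ) := {f | ∀ i, f i ∈ S} with hP
  have hPf : P.Finite := Set.Finite.pi' (fun _ => hSf)
  have hPu : ∀ f ∈ P, ∀ i, ∀ v ∈ S, Function.update f i v ∈ P := by
    intro f hf i v hv k
    by_cases hk : k = i
    · subst hk; simpa using hv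
    · simpa [hk] using hf k
  set V : Set ((ι → ℝ) × (ι → ℝ) × (ι → ℝ) × (ι → ℝ)) :=
    {f | f ∈ P ×ˢ P ×ˢ P ×ˢ P ∧ HoleSys f.1 f.2.1 f.2.2.1 f.2.2.2 H M} with hV
  have hVf : V.Finite := (hPf.prod (hPf.prod (hPf.prod hPf))).subset (fun f hf => hf.1)
  have hVn : V.Nonempty := by
    refine ⟨(a, b, c, d), ⟨?_, ?_, ?_, ?_⟩, h⟩ <;> intro i <;> simp [hS]
  obtain ⟨⟨a', b', c', d'⟩, ⟨⟨pa, pb, pc, pd⟩, h'⟩, hmax⟩ := Set.exists_max_image V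
    (fun f => ∑ i, f.2.1 i - ∑ i, f.1 i + (∑ i, f.2.2.2 i - ∑ i, f.2.2.1 i)) hVf hVn
  simp only at pa pb pc pd h' hmax
  refine ⟨a', b', c', d', h', ?_⟩
  refine { h' with up := ?_, down := ?_, right := ?_, left := ?_ }
  · intro i
    by_contra! hcon
    have hlt : d' i < M := lt_of_le_of_ne (h'.dM i) hcon.1
    have hg := h'.growUp i (by rintro ⟨j, j1, j2, j3⟩; linarith [hcon.2 j j1 j2])
    have := hmax (a', b', c', Function.update d' i M) ⟨⟨pa, pb, pc, hPu _ pd _ _ hM⟩, hg⟩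
    have := sum_update_lt d' i M hlt
    simp only at *
    linarith
  · intro i
    by_contra! hcon
    have hlt : -M < c' i := lt_of_le_of_ne (h'.lc i) (Ne.symm hcon.1)
    have hg := h'.growDown i (by rintro ⟨j, j1, j2, j3⟩; linarith [hcon.2 j j1 j2])
    have := hmax (a', b', Function.update c' i (-M), d') ⟨⟨pa, pb, hPu _ pc _ _ hM', pd⟩, hg⟩
    have := sum_update_gt c' i (-M) hlt
    simp only at *
    linarith
  · intro i
    by_contra! hcon
    have hlt : b' i < M := lt_of_le_of_ne (h'.bM i) hcon.1
    have hg := h'.growRight i (by rintro ⟨j, j1, j2, j3⟩; linarith [hcon.2 j j1 j2])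
    have := hmax (a', Function.update b' i M, c', d') ⟨⟨pa, hPu _ pb _ _ hM, pc, pd⟩, hg⟩
    have := sum_update_lt b' i M hlt
    simp only at *
    linarith
  · intro i
    by_contra! hcon
    have hlt : -M < a' i := lt_of_le_of_ne (h'.la i) (Ne.symm hcon.1)
    have hg := h'.growLeft i (by rintro ⟨j, j1, j2, j3⟩; linarith [hcon.2 j j1 j2])
    have := hmax (Function.update a' i (-M), b', c', d') ⟨⟨hPu _ pa _ _ hM', pb, pc, pd⟩, hg⟩
    have := sum_update_gt a' i (-M) hlt
    simp only at *
    linarith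

theorem HoleSys.bound [Fintype ι] [Fintype J] (h : HoleSys a b c d H M)
    (hc : 3 ≤ Fintype.card ι) : Fintype.card J + 3 ≤ Fintype.card ι := by
  obtain ⟨a', b', c', d', h1, h2⟩ := h.exists_ext
  have := h1.count
  have := h2.waste hc
  omega
end

theorem isPreconnected_outside (M : ℝ) :
    IsPreconnected {p : ℝ × ℝ | M < p.1 ∨ M < p.2 ∨ p.1 < -M ∨ p.2 < -M} := by
  have h1 : IsPreconnected (Ioi M ×ˢ (univ : Set ℝ)) := isPreconnected_Ioi.prod isPreconnected_univ
  have h2 : IsPreconnected ((univ : Set ℝ) ×ˢ Ioi M) := isPreconnected_univ.prod isPreconnected_Ioi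
  have h3 : IsPreconnected (Iio (-M) ×ˢ (univ : Set ℝ)) :=
    isPreconnected_Iio.prod isPreconnected_univ
  have h4 : IsPreconnected ((univ : Set ℝ) ×ˢ Iio (-M)) :=
    isPreconnected_univ.prod isPreconnected_Iio
  have h12 := IsPreconnected.union' ⟨(M + 1, M + 1), by simp⟩ h1 h2
  have h123 := IsPreconnected.union' ⟨(-M - 1, M + 1), by simp⟩ h12 h3
  have h1234 := IsPreconnected.union' ⟨(M + 1, -M - 1), by simp⟩ h123 h4
  convert h1234 using 1
  ext p
  simp only [mem_ofPred_eq, mem_union, mem_prod, mem_Ioi, mem_Iio, mem_univ, and_true, true_and]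
  tauto

theorem rect_holes_upper_bound (m : ℕ) (hm : 3 ≤ m) (Z : Fin m → Set (ℝ × ℝ))
    (hZ : ∀ i, IsRect (Z i))
    (hdisj : ∀ i j, i ≠ j → Disjoint (interior (Z i)) (interior (Z j))) :
    ({H : Set (ℝ × ℝ) | ∃ x ∈ (⋃ i, Z i)ᶜ,
        H = connectedComponentIn (⋃ i, Z i)ᶜ x}).Finite ∧
    ({H : Set (ℝ × ℝ) | ∃ x ∈ (⋃ i, Z i)ᶜ,
        H = connectedComponentIn (⋃ i, Z i)ᶜ x}).ncard ≤ m - 2 := by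
  choose a b c d hab hcd hZe using hZ
  have hsep : ∀ i j, i ≠ j → b i ≤ a j ∨ b j ≤ a i ∨ d i ≤ c j ∨ d j ≤ c i := by
    intro i j hij
    have hd := hdisj i j hij
    rw [hZe i, hZe j, interior_prod_eq, interior_prod_eq, interior_Icc, interior_Icc,
      interior_Icc, interior_Icc, Set.disjoint_prod, Ioo_disjoint_Ioo, Ioo_disjoint_Ioo] at hd
    have := hab i
    have := hab j
    have := hcd i
    have := hcd j
    rcases hd with hd | hd
    · rcases min_le_iff.1 hd with q | q <;> rcases le_max_iff.1 q with q | q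
      · linarith
      · exact Or.inl q
      · exact Or.inr (Or.inl q)
      · linarith
    · rcases min_le_iff.1 hd with q | q <;> rcases le_max_iff.1 q with q | q
      · linarith
      · exact Or.inr (Or.inr (Or.inl q))
      · exact Or.inr (Or.inr (Or.inr q))
      · linarith
  obtain ⟨M, hM⟩ : ∃ M : ℝ, ∀ i, -M ≤ a i ∧ b i ≤ M ∧ -M ≤ c i ∧ d i ≤ M := by
    refine ⟨∑ i, (|a i| + |b i| + |c i| + |d i|), fun i => ?_⟩
    have := Finset.single_le_sum (f := fun i => |a i| + |b i| + |c i| + |d i|)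
      (fun i _ => by positivity) (Finset.mem_univ i)
    have := neg_abs_le (a i)
    have := le_abs_self (b i)
    have := neg_abs_le (c i)
    have := le_abs_self (d i)
    have := abs_nonneg (a i)
    have := abs_nonneg (b i)
    have := abs_nonneg (c i)
    have := abs_nonneg (d i)
    refine ⟨?_, ?_, ?_, ?_⟩ <;> linarith
  set U : Set (ℝ × ℝ) := (⋃ i, Z i)ᶜ with hU
  have hmemU : ∀ p, p ∈ U ↔ ∀ i, ¬ (a i ≤ p.1 ∧ p.1 ≤ b i ∧ c i ≤ p.2 ∧ p.2 ≤ d i) := by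
    intro p
    simp only [hU, mem_compl_iff, mem_iUnion, not_exists]
    refine forall_congr' fun i => ?_
    rw [hZe i]
    simp only [mem_prod, mem_Icc, and_assoc]
  have hUo : IsOpen U := by
    rw [hU, isOpen_compl_iff]
    refine isClosed_iUnion_of_finite fun i => ?_
    rw [hZe i]
    exact isClosed_Icc.prod isClosed_Icc
  set C : Set (Set (ℝ × ℝ)) := {H | ∃ x ∈ U, H = connectedComponentIn U x} with hC
  set E : Set (ℝ × ℝ) := {p : ℝ × ℝ | M < p.1 ∨ M < p.2 ∨ p.1 < -M ∨ p.2 < -M} with hE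
  have hEU : E ⊆ U := by
    intro p hp
    rw [hmemU]
    rintro i ⟨h1, h2, h3, h4⟩
    obtain ⟨m1, m2, m3, m4⟩ := hM i
    rcases hp with q | q | q | q <;> linarith
  have hEp : (M + 1, (0 : ℝ)) ∈ E := Or.inl (by simp)
  set O := connectedComponentIn U (M + 1, (0 : ℝ)) with hO
  have hEO : E ⊆ O := (isPreconnected_outside M).subset_connectedComponentIn hEp hEU
  have hbox : ∀ H ∈ C, H ≠ O → H ⊆ Icc (-M) M ×ˢ Icc (-M) M := by
    rintro _ ⟨x, hx, rfl⟩ hne p hp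
    by_contra hcon
    have hpE : p ∈ E := by
      simp only [mem_prod, mem_Icc] at hcon
      simp only [hE, mem_ofPred_eq]
      by_contra! hh
      exact hcon ⟨⟨hh.2.2.1, hh.1⟩, hh.2.2.2, hh.2.1⟩
    have h1 := connectedComponentIn_eq hp
    have h2 := connectedComponentIn_eq (hEO hpE)
    exact hne (h1.trans h2.symm)
  have hfin : ∀ F : Finset (Set (ℝ × ℝ)), (F : Set (Set (ℝ × ℝ))) ⊆ C \ {O} → F.card + 3 ≤ m := by
    intro F hF
    have hFC : ∀ j : F, ∃ x ∈ U, (j : Set (ℝ × ℝ)) = connectedComponentIn U x :=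
      fun j => (hF j.2).1
    have hop : ∀ j : F, IsOpen (j : Set (ℝ × ℝ)) := by
      intro j
      obtain ⟨x, hx, hj⟩ := hFC j
      rw [hj]
      exact hUo.connectedComponentIn
    have hsub : ∀ j : F, (j : Set (ℝ × ℝ)) ⊆ U := by
      intro j
      obtain ⟨x, hx, hj⟩ := hFC j
      rw [hj]
      exact connectedComponentIn_subset U x
    have hsys : HoleSys a b c d (fun j : F => (j : Set (ℝ × ℝ))) M := by
      refine ⟨hab, hcd, fun i => (hM i).1, fun i => (hM i).2.1, fun i => (hM i).2.2.1,
        fun i => (hM i).2.2.2, hsep, hop, ?_, ?_, ?_, ?_, ?_⟩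
      · intro j
        obtain ⟨x, hx, hj⟩ := hFC j
        exact ⟨x, by simp only [hj]; exact mem_connectedComponentIn hx⟩
      · intro j
        exact hbox _ (hF j.2).1 (hF j.2).2
      · intro j p hp
        by_contra! hcon
        have hpU : p ∈ U := by
          rw [hmemU]
          rintro i ⟨h1, h2, h3, h4⟩
          linarith [hcon i h1 h2 h3]
        obtain ⟨x, hx, hj⟩ := hFC j
        obtain ⟨q, hq, hq'⟩ := mem_closure_iff.1 hp.1 (connectedComponentIn U p)
          hUo.connectedComponentIn (mem_connectedComponentIn hpU)
        have h1 := connectedComponentIn_eq hq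
        rw [hj] at hq'
        have h2 := connectedComponentIn_eq hq'
        have h3 : p ∈ (j : Set (ℝ × ℝ)) := by
          rw [hj, h2, ← h1]; exact mem_connectedComponentIn hpU
        refine hp.2 ?_
        rw [(hop j).interior_eq]
        exact h3
      · intro j p hp
        exact (hmemU p).1 (hsub j hp)
      · intro j j' p hp hp'
        obtain ⟨x, hx, hj⟩ := hFC j
        obtain ⟨x', hx', hj'⟩ := hFC j'
        simp only [hj] at hp
        simp only [hj'] at hp'
        apply Subtype.ext
        rw [hj, hj', connectedComponentIn_eq hp, connectedComponentIn_eq hp']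
    have := hsys.bound (by simpa using hm)
    simpa using this
  have hBfin : (C \ {O}).Finite := by
    by_contra hinf
    obtain ⟨F, hF, hFc⟩ := Set.Infinite.exists_subset_card_eq hinf m
    have := hfin F hF
    omega
  have hBcard : (C \ {O}).ncard + 3 ≤ m := by
    rw [Set.ncard_eq_toFinset_card _ hBfin]
    exact hfin _ (by simp)
  have hsubs : C ⊆ insert O (C \ {O}) := by
    intro H hH
    by_cases h : H = O
    · exact Or.inl h
    · exact Or.inr ⟨hH, h⟩
  refine ⟨(hBfin.insert O).subset hsubs, ?_⟩
  have h1 := Set.ncard_le_ncard hsubs (hBfin.insert O)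
  have h2 := Set.ncard_insert_le O (C \ {O})
  omega
end

section
/- Let m ≥ 3 and let Z₁, …, Zₘ be pairwise interior-disjoint nondegenerate closed axis-parallel rectangles in the plane ℝ². Then the number of bounded connected components of the complement ℝ² \ (Z₁ ∪ ⋯ ∪ Zₘ) is at most m − 3. -/
/-- A family of `m` boxes `[a i, b i] × [c i, d i]`. -/
structure Fam (m : ℕ) where
  a : Fin m → ℝ
  b : Fin m → ℝ
  c : Fin m → ℝ
  d : Fin m → ℝ

namespace Fam

variable {m : ℕ}

/-- Nondegenerate and pairwise interior-disjoint. -/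
structure Valid (F : Fam m) : Prop where
  ab : ∀ i, F.a i < F.b i
  cd : ∀ i, F.c i < F.d i
  dj : ∀ i j, i ≠ j → F.b i ≤ F.a j ∨ F.b j ≤ F.a i ∨ F.d i ≤ F.c j ∨ F.d j ≤ F.c i

/-- The point `(x, y)` is covered. -/
def Cov (F : Fam m) (x y : ℝ) : Prop :=
  ∃ i, F.a i ≤ x ∧ x ≤ F.b i ∧ F.c i ≤ y ∧ y ≤ F.d i

/-- The properties of a bounded component of the complement that are used. -/
structure Hole (F : Fam m) (V : ℝ → ℝ → Prop) : Prop where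
  ne : ∃ x y, V x y
  op : ∀ x y, V x y → ∃ δ > 0, ∀ x' y', |x' - x| < δ → |y' - y| < δ → V x' y'
  bd : ∃ M : ℝ, ∀ x y, V x y → |x| < M ∧ |y| < M
  free : ∀ x y, V x y → ¬ F.Cov x y
  box : ∀ I J : Set ℝ, I.OrdConnected → J.OrdConnected →
    (∀ x ∈ I, ∀ y ∈ J, ¬ F.Cov x y) → ∀ x ∈ I, ∀ y ∈ J, V x y →
    ∀ x' ∈ I, ∀ y' ∈ J, V x' y'

/-- Swap the coordinates. -/
def flip (F : Fam m) : Fam m := ⟨F.c, F.d, F.a, F.b⟩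

/-- Reflect the first coordinate. -/
def negx (F : Fam m) : Fam m := ⟨fun i => -F.b i, fun i => -F.a i, F.c, F.d⟩

/-- Reflect the second coordinate. -/
def negy (F : Fam m) : Fam m := ⟨F.a, F.b, fun i => -F.d i, fun i => -F.c i⟩

theorem Valid.flip {F : Fam m} (h : F.Valid) : F.flip.Valid := by
  refine ⟨h.cd, h.ab, fun i j hij => ?_⟩
  have := h.dj i j hij
  simp only [Fam.flip]
  tauto

theorem Valid.negx {F : Fam m} (h : F.Valid) : F.negx.Valid := by
  refine ⟨fun i => ?_, h.cd, fun i j hij => ?_⟩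
  · have := h.ab i
    simp only [Fam.negx]; linarith
  · have := h.dj i j hij
    simp only [Fam.negx, neg_le_neg_iff]
    tauto

theorem Valid.negy {F : Fam m} (h : F.Valid) : F.negy.Valid := h.flip.negx.flip

theorem cov_flip {F : Fam m} {x y : ℝ} : F.flip.Cov x y ↔ F.Cov y x := by
  simp only [Cov, Fam.flip]
  constructor <;> rintro ⟨i, h1, h2, h3, h4⟩ <;> exact ⟨i, h3, h4, h1, h2⟩

theorem cov_negx {F : Fam m} {x y : ℝ} : F.negx.Cov x y ↔ F.Cov (-x) y := by
  simp only [Cov, Fam.negx]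
  constructor <;> rintro ⟨i, h1, h2, h3, h4⟩ <;>
    exact ⟨i, by linarith, by linarith, h3, h4⟩

theorem cov_negy {F : Fam m} {x y : ℝ} : F.negy.Cov x y ↔ F.Cov x (-y) := by
  simp only [Cov, Fam.negy]
  constructor <;> rintro ⟨i, h1, h2, h3, h4⟩ <;>
    exact ⟨i, h1, h2, by linarith, by linarith⟩

theorem Hole.flip {F : Fam m} {V : ℝ → ℝ → Prop} (h : F.Hole V) :
    F.flip.Hole (fun x y => V y x) := by
  refine ⟨?_, ?_, ?_, ?_, ?_⟩
  · obtain ⟨x, y, hv⟩ := h.ne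
    exact ⟨y, x, hv⟩
  · intro x y hv
    obtain ⟨δ, hδ, H⟩ := h.op _ _ hv
    exact ⟨δ, hδ, fun x' y' h1 h2 => H _ _ h2 h1⟩
  · obtain ⟨M, hM⟩ := h.bd
    exact ⟨M, fun x y hv => (hM _ _ hv).symm⟩
  · intro x y hv hc
    exact h.free _ _ hv (cov_flip.1 hc)
  · intro I J hI hJ hf x hx y hy hv x' hx' y' hy'
    exact h.box J I hJ hI (fun u hu v hv hc => hf v hv u hu (cov_flip.2 hc)) y hy x hx hv
      y' hy' x' hx'

theorem Hole.negx {F : Fam m} {V : ℝ → ℝ → Prop} (h : F.Hole V) :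
    F.negx.Hole (fun x y => V (-x) y) := by
  refine ⟨?_, ?_, ?_, ?_, ?_⟩
  · obtain ⟨x, y, hv⟩ := h.ne
    exact ⟨-x, y, by simpa using hv⟩
  · intro x y hv
    obtain ⟨δ, hδ, H⟩ := h.op _ _ hv
    refine ⟨δ, hδ, fun x' y' h1 h2 => H _ _ ?_ h2⟩
    rw [← abs_neg]
    convert h1 using 2
    ring
  · obtain ⟨M, hM⟩ := h.bd
    exact ⟨M, fun x y hv => by simpa using hM _ _ hv⟩
  · intro x y hv hc
    exact h.free _ _ hv (cov_negx.1 hc)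
  · intro I J hI hJ hf x hx y hy hv x' hx' y' hy'
    refine h.box {t | -t ∈ I} J ⟨fun u hu v hv t ht => ?_⟩ hJ
      (fun u hu v hv hc => hf (-u) hu v hv (cov_negx.2 (by simpa using hc))) (-x)
      (by simpa using hx) y hy hv (-x') (by simpa using hx') y' hy'
    exact hI.out hv hu ⟨by linarith [ht.2], by linarith [ht.1]⟩

theorem Hole.negy {F : Fam m} {V : ℝ → ℝ → Prop} (h : F.Hole V) :
    F.negy.Hole (fun x y => V x (-y)) := h.flip.negx.flip

theorem Hole.left {F : Fam m} {V : ℝ → ℝ → Prop} (h : F.Hole V) {x y : ℝ} (hv : V x y) :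
    ∃ x' ≤ x, F.Cov x' y := by
  by_contra hcon
  push Not at hcon
  obtain ⟨M, hM⟩ := h.bd
  have hx := (abs_lt.1 (hM _ _ hv).1).1
  have := h.box (Set.Iic x) {y} Set.ordConnected_Iic Set.ordConnected_singleton
    (by rintro u hu v rfl; exact hcon u hu) x (Set.mem_Iic.2 le_rfl) y rfl hv (-M)
    (Set.mem_Iic.2 hx.le) y rfl
  have := (abs_lt.1 (hM _ _ this).1).1
  linarith

theorem Hole.right {F : Fam m} {V : ℝ → ℝ → Prop} (h : F.Hole V) {x y : ℝ} (hv : V x y) :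
    ∃ x' ≥ x, F.Cov x' y := by
  obtain ⟨x', h1, h2⟩ := h.negx.left (x := -x) (y := y) (by simpa using hv)
  exact ⟨-x', by linarith, cov_negx.1 h2⟩

theorem Hole.down {F : Fam m} {V : ℝ → ℝ → Prop} (h : F.Hole V) {x y : ℝ} (hv : V x y) :
    ∃ y' ≤ y, F.Cov x y' := by
  obtain ⟨x', h1, h2⟩ := h.flip.left (x := y) (y := x) hv
  exact ⟨x', h1, cov_flip.1 h2⟩

theorem Hole.up {F : Fam m} {V : ℝ → ℝ → Prop} (h : F.Hole V) {x y : ℝ} (hv : V x y) :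
    ∃ y' ≥ y, F.Cov x y' := by
  obtain ⟨x', h1, h2⟩ := h.flip.right (x := y) (y := x) hv
  exact ⟨x', h1, cov_flip.1 h2⟩

/-- A hole needs four rectangles. -/
theorem Hole.four {F : Fam m} {V : ℝ → ℝ → Prop} (h : F.Hole V) : 4 ≤ m := by
  obtain ⟨x, y, hv⟩ := h.ne
  have hf := h.free _ _ hv
  obtain ⟨x1, h1, i, hi⟩ := h.left hv
  obtain ⟨x2, h2, j, hj⟩ := h.right hv
  obtain ⟨y1, h3, k, hk⟩ := h.down hv
  obtain ⟨y2, h4, l, hl⟩ := h.up hv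
  have e1 : i ≠ j := by rintro rfl; exact hf ⟨i, by linarith, by linarith, by linarith, by linarith⟩
  have e2 : i ≠ k := by rintro rfl; exact hf ⟨i, by linarith, by linarith, by linarith, by linarith⟩
  have e3 : i ≠ l := by rintro rfl; exact hf ⟨i, by linarith, by linarith, by linarith, by linarith⟩
  have e4 : j ≠ k := by rintro rfl; exact hf ⟨j, by linarith, by linarith, by linarith, by linarith⟩
  have e5 : j ≠ l := by rintro rfl; exact hf ⟨j, by linarith, by linarith, by linarith, by linarith⟩
  have e6 : k ≠ l := by rintro rfl; exact hf ⟨k, by linarith, by linarith, by linarith, by linarith⟩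
  have : ({i, j, k, l} : Finset (Fin m)).card = 4 := by
    rw [Finset.card_insert_of_notMem (by simp [*]), Finset.card_insert_of_notMem (by simp [*]),
      Finset.card_insert_of_notMem (by simp [*]), Finset.card_singleton]
  have h5 := Finset.card_le_univ ({i, j, k, l} : Finset (Fin m))
  rw [this, Fintype.card_fin] at h5
  exact h5

/-- Distinct coordinates differ by at least `ε`. -/
structure Sep (F : Fam m) (ε : ℝ) : Prop where
  pos : 0 < ε
  aa : ∀ i j, F.a i < F.a j → F.a i + ε ≤ F.a j
  ab : ∀ i j, F.a i < F.b j → F.a i + ε ≤ F.b j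
  ba : ∀ i j, F.b i < F.a j → F.b i + ε ≤ F.a j
  bb : ∀ i j, F.b i < F.b j → F.b i + ε ≤ F.b j
  cc : ∀ i j, F.c i < F.c j → F.c i + ε ≤ F.c j
  cd : ∀ i j, F.c i < F.d j → F.c i + ε ≤ F.d j
  dc : ∀ i j, F.d i < F.c j → F.d i + ε ≤ F.c j
  dd : ∀ i j, F.d i < F.d j → F.d i + ε ≤ F.d j

theorem exists_eps (u v : Fin m → ℝ) :
    ∀ᶠ ε in nhdsWithin (0 : ℝ) (Set.Ioi 0), ∀ i j, u i < v j → u i + ε ≤ v j := by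
  rw [Filter.eventually_all]
  intro i
  rw [Filter.eventually_all]
  intro j
  by_cases h : u i < v j
  · filter_upwards [Ioo_mem_nhdsGT (sub_pos.2 h)] with ε hε _
    linarith [hε.2]
  · exact Filter.Eventually.of_forall fun ε hh => absurd hh h

theorem exists_sep (F : Fam m) : ∃ ε, F.Sep ε := by
  have := (exists_eps F.a F.a).and <| (exists_eps F.a F.b).and <| (exists_eps F.b F.a).and <|
    (exists_eps F.b F.b).and <| (exists_eps F.c F.c).and <| (exists_eps F.c F.d).and <|
    (exists_eps F.d F.c).and <| (exists_eps F.d F.d).and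
      (eventually_mem_nhdsWithin (a := (0:ℝ)) (s := Set.Ioi 0))
  obtain ⟨ε, h1, h2, h3, h4, h5, h6, h7, h8, h9⟩ := this.exists
  exact ⟨ε, h9, h1, h2, h3, h4, h5, h6, h7, h8⟩

theorem Sep.flip {F : Fam m} {ε : ℝ} (h : F.Sep ε) : F.flip.Sep ε :=
  ⟨h.pos, h.cc, h.cd, h.dc, h.dd, h.aa, h.ab, h.ba, h.bb⟩

theorem Sep.negx {F : Fam m} {ε : ℝ} (h : F.Sep ε) : F.negx.Sep ε := by
  refine ⟨h.pos, ?_, ?_, ?_, ?_, h.cc, h.cd, h.dc, h.dd⟩ <;> intro i j hij <;>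
    simp only [Fam.negx] at hij ⊢
  · linarith [h.bb j i (by linarith)]
  · linarith [h.ab j i (by linarith)]
  · linarith [h.ba j i (by linarith)]
  · linarith [h.aa j i (by linarith)]

theorem Sep.negy {F : Fam m} {ε : ℝ} (h : F.Sep ε) : F.negy.Sep ε := h.flip.negx.flip

/-- First hit to the left. -/
theorem Hole.leftHit {F : Fam m} {V : ℝ → ℝ → Prop} (h : F.Hole V)
    {J : Set ℝ} (hJ : J.OrdConnected) (hc : ∀ k, F.c k ∉ J) (hd : ∀ k, F.d k ∉ J)
    {x₀ y₀ : ℝ} (hy : y₀ ∈ J) (hv : V x₀ y₀) :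
    ∃ j, F.b j < x₀ ∧ F.c j < y₀ ∧ y₀ < F.d j ∧ ∀ x, F.b j < x → x ≤ x₀ → ∀ y ∈ J, V x y := by
  classical
  have key : ∀ k, ∀ y ∈ J, F.c k ≤ y → y ≤ F.d k → F.c k < y₀ ∧ y₀ < F.d k := by
    intro k y hyJ h1 h2
    constructor
    · by_contra h3
      exact hc k (hJ.out hy hyJ ⟨by linarith, h1⟩)
    · by_contra h3
      exact hd k (hJ.out hyJ hy ⟨h2, by linarith⟩)
  let K : Finset (Fin m) := Finset.univ.filter fun k => F.a k ≤ x₀ ∧ F.c k < y₀ ∧ y₀ < F.d k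
  have hK : K.Nonempty := by
    obtain ⟨x', hx', k, h1, h2, h3, h4⟩ := h.left hv
    obtain ⟨h5, h6⟩ := key k y₀ hy h3 h4
    exact ⟨k, by simp [K]; exact ⟨by linarith, h5, h6⟩⟩
  obtain ⟨j, hj, hmax⟩ := Finset.exists_max_image K F.b hK
  simp only [K, Finset.mem_filter, Finset.mem_univ, true_and] at hj hmax
  have hb : F.b j < x₀ := by
    by_contra h3
    exact h.free _ _ hv ⟨j, hj.1, by linarith, hj.2.1.le, hj.2.2.le⟩
  refine ⟨j, hb, hj.2.1, hj.2.2, ?_⟩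
  intro x h1 h2 y hyJ
  refine h.box (Set.Ioc (F.b j) x₀) J Set.ordConnected_Ioc hJ ?_ x₀ ⟨hb, le_rfl⟩ y₀ hy hv x
    ⟨h1, h2⟩ y hyJ
  rintro u hu w hw ⟨k, h3, h4, h5, h6⟩
  have := hmax k ⟨by linarith [hu.2], key k w hw h5 h6⟩
  linarith [hu.1]

/-- First hit upwards. -/
theorem Hole.upHit {F : Fam m} {V : ℝ → ℝ → Prop} (h : F.Hole V)
    {I : Set ℝ} (hI : I.OrdConnected) (ha : ∀ k, F.a k ∉ I) (hb : ∀ k, F.b k ∉ I)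
    {x₀ y₀ : ℝ} (hx : x₀ ∈ I) (hv : V x₀ y₀) :
    ∃ i, y₀ < F.c i ∧ F.a i < x₀ ∧ x₀ < F.b i ∧ ∀ y, y₀ ≤ y → y < F.c i → ∀ x ∈ I, V x y := by
  obtain ⟨i, h1, h2, h3, h4⟩ := (h.flip.negx).leftHit (J := I) hI ha hb (x₀ := -y₀) (y₀ := x₀) hx
    (by simpa using hv)
  simp only [Fam.flip, Fam.negx] at h1 h2 h3 h4
  refine ⟨i, by linarith, h2, h3, fun y hy1 hy2 x hxI => ?_⟩
  have := h4 (-y) (by linarith) (by linarith) x hxI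
  simpa using this

/-- A grid-free cell that meets a hole is in the hole. -/
theorem Hole.cell {F : Fam m} {V : ℝ → ℝ → Prop} (h : F.Hole V)
    {I J : Set ℝ} (hI : I.OrdConnected) (ha : ∀ k, F.a k ∉ I) (hb : ∀ k, F.b k ∉ I)
    (hJ : J.OrdConnected) (hc : ∀ k, F.c k ∉ J) (hd : ∀ k, F.d k ∉ J)
    {x₀ y₀ : ℝ} (hx : x₀ ∈ I) (hy : y₀ ∈ J) (hv : V x₀ y₀) :
    ∀ x ∈ I, ∀ y ∈ J, V x y := by
  refine h.box I J hI hJ ?_ x₀ hx y₀ hy hv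
  rintro x hxI y hyJ ⟨k, h1, h2, h3, h4⟩
  refine h.free _ _ hv ⟨k, ?_, ?_, ?_, ?_⟩
  · by_contra h5
    exact ha k (hI.out hx hxI ⟨by linarith, h1⟩)
  · by_contra h5
    exact hb k (hI.out hxI hx ⟨h2, by linarith⟩)
  · by_contra h5
    exact hc k (hJ.out hy hyJ ⟨by linarith, h3⟩)
  · by_contra h5
    exact hd k (hJ.out hyJ hy ⟨h4, by linarith⟩)

theorem exists_offgrid (u v : Fin m → ℝ) {s t : ℝ} (h : s < t) :
    ∃ y, s < y ∧ y < t ∧ (∀ k, u k ≠ y) ∧ ∀ k, v k ≠ y := by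
  obtain ⟨y, hy, hn⟩ := ((Set.Ioo_infinite h).sdiff
    ((Set.finite_range u).union (Set.finite_range v))).nonempty
  refine ⟨y, hy.1, hy.2, fun k hk => hn (Or.inl ⟨k, hk⟩), fun k hk => hn (Or.inr ⟨k, hk⟩)⟩

/-- The top left corner of a hole. -/
theorem Hole.topLeft {F : Fam m} {V : ℝ → ℝ → Prop} (h : F.Hole V) {ε : ℝ} (hs : F.Sep ε) :
    ∃ L U, (∀ x y, F.b L < x → x < F.b L + ε → F.c U - ε < y → y < F.c U → V x y) ∧
      F.a U ≤ F.b L ∧ F.b L < F.b U ∧ F.c L < F.c U ∧ F.c U ≤ F.d L := by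
  classical
  have hε := hs.pos
  have ga : ∀ j k, F.a k ∉ Set.Ioo (F.b j) (F.b j + ε) := fun j k hk => by
    linarith [hs.ba j k hk.1, hk.2]
  have gb : ∀ j k, F.b k ∉ Set.Ioo (F.b j) (F.b j + ε) := fun j k hk => by
    linarith [hs.bb j k hk.1, hk.2]
  have gc : ∀ i k, F.c k ∉ Set.Ioo (F.c i - ε) (F.c i) := fun i k hk => by
    linarith [hs.cc k i hk.2, hk.1]
  have gd : ∀ i k, F.d k ∉ Set.Ioo (F.c i - ε) (F.c i) := fun i k hk => by
    linarith [hs.dc k i hk.2, hk.1]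
  let P : Fin m → Fin m → Prop := fun j i =>
    ∀ x y, F.b j < x → x < F.b j + ε → F.c i - ε < y → y < F.c i → V x y
  have cellP : ∀ j i x y, F.b j < x → x < F.b j + ε → F.c i - ε < y → y < F.c i → V x y → P j i := by
    intro j i x y h1 h2 h3 h4 hv x' y' h1' h2' h3' h4'
    exact h.cell Set.ordConnected_Ioo (ga j) (gb j) Set.ordConnected_Ioo (gc i) (gd i)
      (x₀ := x) (y₀ := y) ⟨h1, h2⟩ ⟨h3, h4⟩ hv x' ⟨h1', h2'⟩ y' ⟨h3', h4'⟩
  have hne : ∃ j i, P j i := by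
    obtain ⟨x₀, y₀, hv⟩ := h.ne
    obtain ⟨δ, hδ, H⟩ := h.op _ _ hv
    obtain ⟨y₁, hy1, hy2, hy3, hy4⟩ := exists_offgrid F.c F.d (s := y₀ - δ) (t := y₀ + δ) (by linarith)
    have hv1 : V x₀ y₁ := H x₀ y₁ (by simpa using hδ) (abs_lt.2 ⟨by linarith, by linarith⟩)
    obtain ⟨j, hj1, -, -, hj2⟩ := h.leftHit (J := {y₁}) Set.ordConnected_singleton hy3 hy4 rfl hv1
    obtain ⟨x₁, hx1, hx2⟩ := exists_between (lt_min hj1 (show F.b j < F.b j + ε by linarith))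
    have hv2 : V x₁ y₁ := hj2 x₁ hx1 (hx2.le.trans (min_le_left _ _)) y₁ rfl
    have hx3 := hx2.trans_le (min_le_right _ _)
    obtain ⟨i, hi1, -, -, hi2⟩ := h.upHit (I := Set.Ioo (F.b j) (F.b j + ε)) Set.ordConnected_Ioo
      (ga j) (gb j) ⟨hx1, hx3⟩ hv2
    obtain ⟨y₂, hy5, hy6⟩ := exists_between (max_lt hi1 (show F.c i - ε < F.c i by linarith))
    refine ⟨j, i, cellP j i x₁ y₂ hx1 hx3 ((le_max_right _ _).trans_lt hy5) hy6 ?_⟩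
    exact hi2 y₂ ((le_max_left _ _).trans hy5.le) hy6 x₁ ⟨hx1, hx3⟩
  obtain ⟨j, hj, hjmin⟩ := Finset.exists_min_image (Finset.univ.filter fun j => ∃ i, P j i) F.b
    (by obtain ⟨j, hj⟩ := hne; exact ⟨j, by simpa using hj⟩)
  simp only [Finset.mem_filter, Finset.mem_univ, true_and] at hj hjmin
  obtain ⟨i, hi, himax⟩ := Finset.exists_max_image (Finset.univ.filter fun i => P j i) F.c
    (by obtain ⟨i, hi⟩ := hj; exact ⟨i, by simpa using hi⟩)
  simp only [Finset.mem_filter, Finset.mem_univ, true_and] at hi himax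
  have hv : V (F.b j + ε / 2) (F.c i - ε / 2) :=
    hi _ _ (by linarith) (by linarith) (by linarith) (by linarith)
  obtain ⟨U, hU1, hU2, hU3, hU4⟩ := h.upHit (I := Set.Ioo (F.b j) (F.b j + ε)) Set.ordConnected_Ioo
      (ga j) (gb j) ⟨by linarith, by linarith⟩ hv
  obtain ⟨L, hL1, hL2, hL3, hL4⟩ := h.leftHit (J := Set.Ioo (F.c i - ε) (F.c i))
      Set.ordConnected_Ioo (gc i) (gd i) ⟨by linarith, by linarith⟩ hv
  have eU : F.c U = F.c i := by
    rcases lt_trichotomy (F.c U) (F.c i) with hlt | heq | hgt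
    · linarith [hs.cc _ _ hlt]
    · exact heq
    · have h1 := hs.cc _ _ hgt
      have : P j U := by
        refine cellP j U (F.b j + ε / 2) (F.c U - ε / 2) (by linarith) (by linarith) (by linarith)
          (by linarith) (hU4 _ (by linarith) (by linarith) _ ⟨by linarith, by linarith⟩)
      linarith [himax U this]
  have eL : F.b L = F.b j := by
    rcases lt_trichotomy (F.b L) (F.b j) with hlt | heq | hgt
    · have h1 := hs.bb _ _ hlt
      have : P L i := by
        refine cellP L i (F.b L + ε / 2) (F.c i - ε / 2) (by linarith) (by linarith) (by linarith)
          (by linarith) (hL4 _ (by linarith) (by linarith) _ ⟨by linarith, by linarith⟩)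
      linarith [hjmin L ⟨i, this⟩]
    · exact heq
    · linarith [hs.bb _ _ hgt]
  refine ⟨L, U, ?_, ?_, by linarith, by linarith, ?_⟩
  · rw [eU, eL]; exact hi
  · rw [eL]
    by_contra hcon
    exact ga j U ⟨by linarith, by linarith⟩
  · rw [eU]
    by_contra hcon
    exact gd i L ⟨by linarith, by linarith⟩

/-- The bottom right corner of a hole. -/
theorem Hole.botRight {F : Fam m} {V : ℝ → ℝ → Prop} (h : F.Hole V) {ε : ℝ} (hs : F.Sep ε) :
    ∃ R B, (∀ x y, F.a R - ε < x → x < F.a R → F.d B < y → y < F.d B + ε → V x y) ∧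
      F.a R ≤ F.b B ∧ F.a B < F.a R ∧ F.d B < F.d R ∧ F.c R ≤ F.d B := by
  obtain ⟨R, B, h1, h2, h3, h4, h5⟩ := h.negx.negy.topLeft hs.negx.negy
  simp only [Fam.negx, Fam.negy] at h1 h2 h3 h4 h5
  refine ⟨R, B, fun x y hx1 hx2 hy1 hy2 => ?_, by linarith, by linarith, by linarith, by linarith⟩
  have := h1 (-x) (-y) (by linarith) (by linarith) (by linarith) (by linarith)
  simpa using this

end Fam

namespace Fam

variable {m : ℕ}

/-- Some bottom left corner is at `p`. -/
def BLat (F : Fam m) (p : ℝ × ℝ) : Prop := ∃ i, F.a i = p.1 ∧ F.c i = p.2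

/-- Some top right corner is at `p`. -/
def TRat (F : Fam m) (p : ℝ × ℝ) : Prop := ∃ i, F.b i = p.1 ∧ F.d i = p.2

/-- Abstract counting of marks at corners. -/
theorem count_marks (F : Fam m) {ι : Type} [Fintype ι] (s t : ι → ℝ × ℝ)
    (hs : Function.Injective s) (ht : Function.Injective t)
    (cs : ∀ u, F.BLat (s u) ∨ F.TRat (s u)) (ct : ∀ u, F.BLat (t u) ∨ F.TRat (t u))
    (P : ∀ u w, s u = t w → F.BLat (s u) ∧ F.TRat (s u)) :
    Fintype.card ι ≤ m := by
  classical
  let pos : Fin m ⊕ Fin m → ℝ × ℝ := Sum.elim (fun i => (F.a i, F.c i)) (fun i => (F.b i, F.d i))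
  have h1 : ∀ u, ∃ k : Fin m ⊕ Fin m, pos k = s u ∧ (F.TRat (s u) → k.isRight = true) := by
    intro u
    by_cases h : F.TRat (s u)
    · obtain ⟨i, hi, hj⟩ := h
      exact ⟨Sum.inr i, Prod.ext hi hj, fun _ => rfl⟩
    · obtain ⟨i, hi, hj⟩ := (cs u).resolve_right h
      exact ⟨Sum.inl i, Prod.ext hi hj, fun h' => absurd h' h⟩
  have h2 : ∀ u, ∃ k : Fin m ⊕ Fin m, pos k = t u ∧ (F.BLat (t u) → k.isLeft = true) := by
    intro u
    by_cases h : F.BLat (t u)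
    · obtain ⟨i, hi, hj⟩ := h
      exact ⟨Sum.inl i, Prod.ext hi hj, fun _ => rfl⟩
    · obtain ⟨i, hi, hj⟩ := (ct u).resolve_left h
      exact ⟨Sum.inr i, Prod.ext hi hj, fun h' => absurd h' h⟩
  choose f hf1 hf2 using h1
  choose g hg1 hg2 using h2
  have key : ∀ u w, f u ≠ g w := by
    intro u w h
    have e : s u = t w := by rw [← hf1, ← hg1, h]
    obtain ⟨hb, ht'⟩ := P u w e
    have h3 := hf2 u ht'
    have h4 := hg2 w (e ▸ hb)
    rw [h] at h3
    cases hh : g w <;> simp [hh] at h3 h4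
  have inj : Function.Injective (Sum.elim f g) := by
    rintro (u | u) (w | w) h
    · simp only [Sum.elim_inl] at h
      exact congrArg _ (hs (by rw [← hf1, ← hf1, h]))
    · exact absurd h (key u w)
    · exact absurd h.symm (key w u)
    · simp only [Sum.elim_inr] at h
      exact congrArg _ (ht (by rw [← hg1, ← hg1, h]))
  have := Fintype.card_le_of_injective _ inj
  simp only [Fintype.card_sum, Fintype.card_fin] at this
  omega

/-- The point `(x, y)` is in the open box of size `ε` to the north west of `p`. -/
def NWb (ε : ℝ) (p : ℝ × ℝ) (x y : ℝ) : Prop := p.1 - ε < x ∧ x < p.1 ∧ p.2 < y ∧ y < p.2 + ε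

/-- The point `(x, y)` is in the open box of size `ε` to the south east of `p`. -/
def SEb (ε : ℝ) (p : ℝ × ℝ) (x y : ℝ) : Prop := p.1 < x ∧ x < p.1 + ε ∧ p.2 - ε < y ∧ y < p.2

/-- An outer mark to the north west of `p`. -/
def NWout (F : Fam m) (ε : ℝ) (p : ℝ × ℝ) : Prop :=
  (∀ x y, NWb ε p x y → ¬ F.Cov x y) ∧
    ∃ x y, NWb ε p x y ∧ ((∀ x' ≤ x, ¬ F.Cov x' y) ∨ (∀ y' ≥ y, ¬ F.Cov x y'))

/-- An outer mark to the south east of `p`. -/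
def SEout (F : Fam m) (ε : ℝ) (p : ℝ × ℝ) : Prop :=
  (∀ x y, SEb ε p x y → ¬ F.Cov x y) ∧
    ∃ x y, SEb ε p x y ∧ ((∀ y' ≤ y, ¬ F.Cov x y') ∨ (∀ x' ≥ x, ¬ F.Cov x' y))

theorem Hole.SEmark {F : Fam m} (hF : F.Valid) {V : ℝ → ℝ → Prop} (h : F.Hole V) {ε : ℝ}
    (hs : F.Sep ε) : ∃ p : ℝ × ℝ, (∀ x y, SEb ε p x y → V x y) ∧ (F.BLat p ∨ F.TRat p) ∧
      ((∀ x y, NWb ε p x y → ¬ F.Cov x y) → F.BLat p ∧ F.TRat p) := by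
  obtain ⟨L, U, h1, h2, h3, h4, h5⟩ := h.topLeft hs
  have hLU : L ≠ U := by rintro rfl; linarith
  have hε := hs.pos
  have hor : F.a U = F.b L ∨ F.d L = F.c U := by
    rcases hF.dj L U hLU with h | h | h | h
    · left; linarith
    · linarith [hF.ab L]
    · right; linarith
    · linarith [hF.cd U]
  refine ⟨(F.b L, F.c U), fun x y hxy => h1 x y hxy.1 hxy.2.1 hxy.2.2.1 hxy.2.2.2, ?_, ?_⟩
  · rcases hor with h | h
    · exact Or.inl ⟨U, h, rfl⟩
    · exact Or.inr ⟨L, rfl, h⟩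
  · intro hN
    have hN' := hN (F.b L - ε / 2) (F.c U + ε / 2)
      ⟨by simp only; linarith, by simp only; linarith, by simp only; linarith,
        by simp only; linarith⟩
    have e1 : F.a U = F.b L := by
      by_contra hne
      have := hs.ab U L (lt_of_le_of_ne h2 hne)
      have := hs.cd U U (hF.cd U)
      exact hN' ⟨U, by linarith, by linarith, by linarith, by linarith⟩
    have e2 : F.d L = F.c U := by
      by_contra hne
      have := hs.cd U L (lt_of_le_of_ne h5 (Ne.symm hne))
      have := hs.ab L L (hF.ab L)
      exact hN' ⟨L, by linarith, by linarith, by linarith, by linarith⟩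
    exact ⟨⟨U, e1, rfl⟩, ⟨L, rfl, e2⟩⟩

theorem Hole.NWmark {F : Fam m} (hF : F.Valid) {V : ℝ → ℝ → Prop} (h : F.Hole V) {ε : ℝ}
    (hs : F.Sep ε) : ∃ p : ℝ × ℝ, (∀ x y, NWb ε p x y → V x y) ∧ (F.BLat p ∨ F.TRat p) ∧
      ((∀ x y, SEb ε p x y → ¬ F.Cov x y) → F.BLat p ∧ F.TRat p) := by
  obtain ⟨R, B, h1, h2, h3, h4, h5⟩ := h.botRight hs
  have hLU : R ≠ B := by rintro rfl; linarith
  have hε := hs.pos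
  have hor : F.b B = F.a R ∨ F.c R = F.d B := by
    rcases hF.dj R B hLU with h | h | h | h
    · linarith [hF.ab R]
    · left; linarith
    · linarith [hF.cd B]
    · right; linarith
  refine ⟨(F.a R, F.d B), fun x y hxy => h1 x y hxy.1 hxy.2.1 hxy.2.2.1 hxy.2.2.2, ?_, ?_⟩
  · rcases hor with h | h
    · exact Or.inr ⟨B, h, rfl⟩
    · exact Or.inl ⟨R, rfl, h⟩
  · intro hN
    have hN' := hN (F.a R + ε / 2) (F.d B - ε / 2)
      ⟨by simp only; linarith, by simp only; linarith, by simp only; linarith,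
        by simp only; linarith⟩
    have e1 : F.b B = F.a R := by
      by_contra hne
      have := hs.ab R B (lt_of_le_of_ne h2 (Ne.symm hne))
      have := hs.cd B B (hF.cd B)
      exact hN' ⟨B, by linarith, by linarith, by linarith, by linarith⟩
    have e2 : F.c R = F.d B := by
      by_contra hne
      have := hs.cd R B (lt_of_le_of_ne h5 hne)
      have := hs.ab R R (hF.ab R)
      exact hN' ⟨R, by linarith, by linarith, by linarith, by linarith⟩
    exact ⟨⟨R, rfl, e2⟩, ⟨B, e1, rfl⟩⟩

theorem count_holes {F : Fam m} (hF : F.Valid) {ε : ℝ} (hs : F.Sep ε) {n : ℕ}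
    (V : Fin n → ℝ → ℝ → Prop) (hV : ∀ i, F.Hole (V i))
    (hd : ∀ i j x y, V i x y → V j x y → i = j)
    (s t : Fin 3 → ℝ × ℝ) (is : Function.Injective s) (it : Function.Injective t)
    (cs : ∀ u, F.BLat (s u) ∨ F.TRat (s u)) (ct : ∀ u, F.BLat (t u) ∨ F.TRat (t u))
    (os : ∀ u, F.SEout ε (s u)) (ot : ∀ u, F.NWout ε (t u))
    (P : ∀ u w, s u = t w → F.BLat (s u) ∧ F.TRat (s u)) : n + 3 ≤ m := by
  have hε := hs.pos
  choose p hp1 hp2 hp3 using fun i => (hV i).SEmark hF hs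
  choose q hq1 hq2 hq3 using fun i => (hV i).NWmark hF hs
  have nS : ∀ i u, p i ≠ s u := by
    intro i u h
    obtain ⟨-, x, y, hxy, ho⟩ := os u
    have hv := hp1 i x y (h ▸ hxy)
    rcases ho with ho | ho
    · obtain ⟨y', h1, h2⟩ := (hV i).down hv
      exact ho y' h1 h2
    · obtain ⟨y', h1, h2⟩ := (hV i).right hv
      exact ho y' h1 h2
  have nT : ∀ i u, q i ≠ t u := by
    intro i u h
    obtain ⟨-, x, y, hxy, ho⟩ := ot u
    have hv := hq1 i x y (h ▸ hxy)
    rcases ho with ho | ho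
    · obtain ⟨y', h1, h2⟩ := (hV i).left hv
      exact ho y' h1 h2
    · obtain ⟨y', h1, h2⟩ := (hV i).up hv
      exact ho y' h1 h2
  have ip : Function.Injective p := by
    intro i j h
    have hb : SEb ε (p i) ((p i).1 + ε / 2) ((p i).2 - ε / 2) :=
      ⟨by linarith, by linarith, by linarith, by linarith⟩
    exact hd i j _ _ (hp1 i _ _ hb) (hp1 j _ _ (h ▸ hb))
  have iq : Function.Injective q := by
    intro i j h
    have hb : NWb ε (q i) ((q i).1 - ε / 2) ((q i).2 + ε / 2) :=
      ⟨by linarith, by linarith, by linarith, by linarith⟩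
    exact hd i j _ _ (hq1 i _ _ hb) (hq1 j _ _ (h ▸ hb))
  have := count_marks F (ι := Fin n ⊕ Fin 3) (Sum.elim p s) (Sum.elim q t)
    (ip.sumElim is nS) (iq.sumElim it nT)
    (by rintro (u | u); exacts [hp2 u, cs u]) (by rintro (u | u); exacts [hq2 u, ct u])
    (by
      rintro (u | u) (w | w) h <;> simp only [Sum.elim_inl, Sum.elim_inr] at h ⊢
      · exact hp3 u fun x y hxy => (hV w).free _ _ (hq1 w x y (h ▸ hxy))
      · exact hp3 u fun x y hxy => (ot w).1 x y (h ▸ hxy)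
      · rw [h]; exact hq3 w fun x y hxy => (os u).1 x y (h ▸ hxy)
      · exact P u w h)
  simpa using this

end Fam

namespace Fam

variable {m : ℕ}

theorem Valid.BL_inj {F : Fam m} (hF : F.Valid) {i j : Fin m} (h1 : F.a i = F.a j)
    (h2 : F.c i = F.c j) : i = j := by
  by_contra h
  have := hF.ab i
  have := hF.ab j
  have := hF.cd i
  have := hF.cd j
  rcases hF.dj i j h with h | h | h | h <;> linarith

theorem Valid.TR_inj {F : Fam m} (hF : F.Valid) {i j : Fin m} (h1 : F.b i = F.b j)
    (h2 : F.d i = F.d j) : i = j := by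
  by_contra h
  have := hF.ab i
  have := hF.ab j
  have := hF.cd i
  have := hF.cd j
  rcases hF.dj i j h with h | h | h | h <;> linarith

theorem NWouter {F : Fam m} (hF : F.Valid) {ε : ℝ} (hε : 0 < ε) {A D : Fin m}
    (hA : ∀ i, F.a A ≤ F.a i) (hD : ∀ i, F.d i ≤ F.d D) :
    F.NWout ε (F.a A, F.c A) ∧ F.NWout ε (F.b D, F.d D) ∧
      ∃ T, F.NWout ε T ∧ ((∃ E, F.b E ≤ F.a D ∧ F.c D < F.d E ∧ T = (F.b E, F.d E)) ∨
        (T = (F.a D, F.c D) ∧ ∀ E, F.b E ≤ F.a D → F.d E ≤ F.c D)) := by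
  classical
  have nb : ∀ p : ℝ × ℝ, NWb ε p (p.1 - ε / 2) (p.2 + ε / 2) := fun p =>
    ⟨by linarith, by linarith, by linarith, by linarith⟩
  refine ⟨⟨?_, _, _, nb _, Or.inl ?_⟩, ⟨?_, _, _, nb _, Or.inr ?_⟩, ?_⟩
  · rintro x y ⟨-, h1, -, -⟩ ⟨k, h2, -⟩
    simp only at h1
    linarith [hA k]
  · rintro x h1 ⟨k, h2, -⟩
    simp only at h1
    linarith [hA k]
  · rintro x y ⟨-, -, h1, -⟩ ⟨k, -, -, -, h2⟩
    simp only at h1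
    linarith [hD k]
  · rintro x h1 ⟨k, -, -, -, h2⟩
    simp only at h1
    linarith [hD k]
  · have key : ∀ x y k, x < F.a D → F.c D < y → F.a k ≤ x → y ≤ F.d k → F.b k ≤ F.a D := by
      intro x y k h1 h2 h3 h4
      have := hF.ab D
      have hk : k ≠ D := by rintro rfl; linarith
      rcases hF.dj k D hk with h | h | h | h
      · exact h
      · linarith
      · linarith
      · linarith [hD k, hF.cd k]
    by_cases hE : ∃ E, F.b E ≤ F.a D ∧ F.c D < F.d E
    · obtain ⟨E, hE1, hE2⟩ := Finset.exists_max_image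
        (Finset.univ.filter fun E => F.b E ≤ F.a D ∧ F.c D < F.d E) F.d
        (by obtain ⟨E, hE⟩ := hE; exact ⟨E, by simpa using hE⟩)
      simp only [Finset.mem_filter, Finset.mem_univ, true_and] at hE1 hE2
      have main : ∀ x y, x < F.b E → F.d E < y → ¬ F.Cov x y := by
        rintro x y h1 h2 ⟨k, h3, h4, h5, h6⟩
        have := key x y k (by linarith) (by linarith) h3 h6
        linarith [hE2 k ⟨this, by linarith⟩]
      refine ⟨(F.b E, F.d E), ⟨?_, _, _, nb _, Or.inl ?_⟩, Or.inl ⟨E, hE1.1, hE1.2, rfl⟩⟩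
      · intro x y h
        exact main x y h.2.1 h.2.2.1
      · intro x h
        refine main x _ ?_ ?_ <;> simp only at h ⊢ <;> linarith
    · push Not at hE
      have main : ∀ x y, x < F.a D → F.c D < y → ¬ F.Cov x y := by
        rintro x y h1 h2 ⟨k, h3, h4, h5, h6⟩
        have := key x y k (by linarith) (by linarith) h3 h6
        linarith [hE k this]
      refine ⟨(F.a D, F.c D), ⟨?_, _, _, nb _, Or.inl ?_⟩, Or.inr ⟨rfl, hE⟩⟩
      · intro x y h
        exact main x y h.2.1 h.2.2.1
      · intro x h
        refine main x _ ?_ ?_ <;> simp only at h ⊢ <;> linarith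

theorem SEout_of_flip {F : Fam m} {ε : ℝ} {p : ℝ × ℝ} (h : F.flip.NWout ε (p.2, p.1)) :
    F.SEout ε p := by
  obtain ⟨h1, x, y, ⟨h2, h3, h4, h5⟩, h6⟩ := h
  refine ⟨fun x y hxy hc => h1 y x ⟨hxy.2.2.1, hxy.2.2.2, hxy.1, hxy.2.1⟩ (cov_flip.2 hc),
    y, x, ⟨h4, h5, h2, h3⟩, ?_⟩
  simpa only [cov_flip] using h6

theorem count_of_extremal {F : Fam m} (hF : F.Valid) {n : ℕ}
    (V : Fin n → ℝ → ℝ → Prop) (hV : ∀ i, F.Hole (V i))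
    (hd : ∀ i j x y, V i x y → V j x y → i = j) {A B C D : Fin m}
    (hA : ∀ i, F.a A ≤ F.a i) (hD : ∀ i, F.d i ≤ F.d D)
    (hB : ∀ i, F.c B ≤ F.c i) (hC : ∀ i, F.b i ≤ F.b C)
    (hAD : A ≠ D) (hDC : D ≠ C) (hCB : C ≠ B) (hBA : B ≠ A) : n + 3 ≤ m := by
  obtain ⟨ε, hs⟩ := F.exists_sep
  obtain ⟨t0, t1, T, t2, hT⟩ := NWouter hF hs.pos hA hD
  obtain ⟨s0, s1, S', s2, hS⟩ := NWouter (F := F.flip) hF.flip hs.pos (A := B) (D := C) hB hC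
  obtain ⟨S, rfl⟩ : ∃ S : ℝ × ℝ, S' = (S.2, S.1) := ⟨(S'.2, S'.1), rfl⟩
  replace s0 : F.SEout ε (F.a B, F.c B) := SEout_of_flip s0
  replace s1 : F.SEout ε (F.b C, F.d C) := SEout_of_flip s1
  replace s2 := SEout_of_flip s2
  simp only [Fam.flip, Prod.mk.injEq] at hS
  obtain ⟨Sx, Sy⟩ := S
  obtain ⟨Tx, Ty⟩ := T
  simp only [Prod.mk.injEq] at hS hT
  have a1 := hF.ab A
  have a2 := hF.ab B
  have a3 := hF.ab C
  have a4 := hF.ab D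
  have c1 := hF.cd A
  have c2 := hF.cd B
  have c3 := hF.cd C
  have c4 := hF.cd D
  have pSs : ∀ E, F.a E < F.b E ∧ F.a A ≤ F.a E ∧ F.b E ≤ F.b C ∧ F.c E < F.d E ∧ F.c B ≤ F.c E ∧
      F.d E ≤ F.d D := fun E => ⟨hF.ab E, hA E, hC E, hF.cd E, hB E, hD E⟩
  refine count_holes hF hs V hV hd ![(F.a B, F.c B), (F.b C, F.d C), (Sx, Sy)]
    ![(F.a A, F.c A), (F.b D, F.d D), (Tx, Ty)] ?_ ?_ ?_ ?_ ?_ ?_ ?_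
  · have e1 : (F.a B, F.c B) ≠ (F.b C, F.d C) := by
      intro h; simp only [Prod.mk.injEq] at h; linarith [pSs B, pSs C]
    have e2 : (F.a B, F.c B) ≠ (Sx, Sy) := by
      intro h
      simp only [Prod.mk.injEq] at h
      rcases hS with ⟨E, h1, h2, h3, h4⟩ | ⟨⟨h3, h4⟩, h1⟩
      · linarith [pSs B, pSs E]
      · exact hCB (hF.BL_inj (by linarith) (by linarith))
    have e3 : (F.b C, F.d C) ≠ (Sx, Sy) := by
      intro h
      simp only [Prod.mk.injEq] at h
      rcases hS with ⟨E, h1, h2, h3, h4⟩ | ⟨⟨h3, h4⟩, h1⟩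
      · linarith [pSs C, pSs E]
      · linarith
    intro u w h
    fin_cases u <;> fin_cases w <;> simp_all
  · have e1 : (F.a A, F.c A) ≠ (F.b D, F.d D) := by
      intro h; simp only [Prod.mk.injEq] at h; linarith [pSs A, pSs D]
    have e2 : (F.a A, F.c A) ≠ (Tx, Ty) := by
      intro h
      simp only [Prod.mk.injEq] at h
      rcases hT with ⟨E, h1, h2, h3, h4⟩ | ⟨⟨h3, h4⟩, h1⟩
      · linarith [pSs A, pSs E]
      · exact hAD (hF.BL_inj (by linarith) (by linarith))
    have e3 : (F.b D, F.d D) ≠ (Tx, Ty) := by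
      intro h
      simp only [Prod.mk.injEq] at h
      rcases hT with ⟨E, h1, h2, h3, h4⟩ | ⟨⟨h3, h4⟩, h1⟩
      · linarith [pSs D, pSs E]
      · linarith
    intro u w h
    fin_cases u <;> fin_cases w <;> simp_all
  · intro u
    fin_cases u
    · exact Or.inl ⟨B, rfl, rfl⟩
    · exact Or.inr ⟨C, rfl, rfl⟩
    · rcases hS with ⟨E, h1, h2, h3, h4⟩ | ⟨⟨h3, h4⟩, h1⟩
      · exact Or.inr ⟨E, h4.symm, h3.symm⟩
      · exact Or.inl ⟨C, h4.symm, h3.symm⟩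
  · intro u
    fin_cases u
    · exact Or.inl ⟨A, rfl, rfl⟩
    · exact Or.inr ⟨D, rfl, rfl⟩
    · rcases hT with ⟨E, h1, h2, h3, h4⟩ | ⟨⟨h3, h4⟩, h1⟩
      · exact Or.inr ⟨E, h3.symm, h4.symm⟩
      · exact Or.inl ⟨D, h3.symm, h4.symm⟩
  · intro u; fin_cases u; exacts [s0, s1, s2]
  · intro u; fin_cases u; exacts [t0, t1, t2]
  · intro u w h
    fin_cases u <;> fin_cases w <;> simp at h ⊢ <;> obtain ⟨e1, e2⟩ := h
    · exact absurd (hF.BL_inj e1 e2) hBA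
    · linarith [pSs D]
    · rcases hT with ⟨E, h1, h2, h3, h4⟩ | ⟨⟨h3, h4⟩, h1⟩
      · exact ⟨⟨B, rfl, rfl⟩, ⟨E, by simp only; linarith, by simp only; linarith⟩⟩
      · exfalso
        have hBD : B = D := hF.BL_inj (by linarith) (by linarith)
        subst hBD
        have := h1 A
        rcases hF.dj A B hAD with h | h | h | h
        · linarith [this h, pSs A]
        · linarith [pSs B]
        · linarith [pSs A]
        · linarith [pSs A]
    · linarith [pSs C]
    · exact absurd (hF.TR_inj e1 e2) hDC.symm
    · rcases hT with ⟨E, h1, h2, h3, h4⟩ | ⟨⟨h3, h4⟩, h1⟩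
      · linarith [pSs D]
      · exact ⟨⟨D, by simp only; linarith, by simp only; linarith⟩, ⟨C, rfl, rfl⟩⟩
    · rcases hS with ⟨E, h1, h2, h3, h4⟩ | ⟨⟨h3, h4⟩, h1⟩
      · exact ⟨⟨A, e1.symm, e2.symm⟩, ⟨E, by simp only; linarith, by simp only; linarith⟩⟩
      · exfalso
        have hBD : A = C := hF.BL_inj (by linarith) (by linarith)
        subst hBD
        have := h1 B
        rcases hF.dj A B hCB with h | h | h | h
        · linarith [pSs B]
        · linarith [pSs B]
        · linarith [pSs A]
        · linarith [pSs B, this h]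
    · rcases hS with ⟨E, h1, h2, h3, h4⟩ | ⟨⟨h3, h4⟩, h1⟩
      · linarith [pSs C]
      · exact ⟨⟨C, by simp only; linarith, by simp only; linarith⟩, ⟨D, e1.symm, e2.symm⟩⟩
    · rcases hS with ⟨E, h1, h2, h3, h4⟩ | ⟨⟨h3, h4⟩, h1⟩ <;>
        rcases hT with ⟨E', h1', h2', h3', h4'⟩ | ⟨⟨h3', h4'⟩, h1'⟩
      · exfalso
        rcases hF.dj C D hDC.symm with h | h | h | h
        · linarith [pSs E, pSs E', pSs D]
        · linarith [pSs E, pSs E', pSs D]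
        · linarith [pSs E, pSs E', pSs D]
        · linarith [pSs E, pSs E', pSs C]
      · exact ⟨⟨D, by simp only; linarith, by simp only; linarith⟩,
          ⟨E, by simp only; linarith, by simp only; linarith⟩⟩
      · exact ⟨⟨C, by simp only; linarith, by simp only; linarith⟩,
          ⟨E', by simp only; linarith, by simp only; linarith⟩⟩
      · exact absurd (hF.BL_inj (by linarith) (by linarith)) hDC

end Fam

namespace Fam

variable {m : ℕ}

/-- The bounding walls. -/
structure InWalls (F : Fam m) (x0 x1 y0 y1 : ℝ) : Prop where
  a : ∀ i, x0 ≤ F.a i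
  b : ∀ i, F.b i ≤ x1
  c : ∀ i, y0 ≤ F.c i
  d : ∀ i, F.d i ≤ y1

/-- Every rectangle touches the left wall or is blocked from the left. -/
def SatL (F : Fam m) (x0 : ℝ) : Prop :=
  ∀ i, F.a i = x0 ∨ ∃ k, F.b k ≤ F.a i ∧ F.c k < F.d i ∧ F.c i < F.d k

def SatR (F : Fam m) (x1 : ℝ) : Prop :=
  ∀ i, F.b i = x1 ∨ ∃ k, F.b i ≤ F.a k ∧ F.c k < F.d i ∧ F.c i < F.d k

def SatD (F : Fam m) (y0 : ℝ) : Prop :=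
  ∀ i, F.c i = y0 ∨ ∃ k, F.d k ≤ F.c i ∧ F.a k < F.b i ∧ F.a i < F.b k

def SatU (F : Fam m) (y1 : ℝ) : Prop :=
  ∀ i, F.d i = y1 ∨ ∃ k, F.d i ≤ F.c k ∧ F.a k < F.b i ∧ F.a i < F.b k

/-- Extend the rectangle `i` to the left. -/
def ext (F : Fam m) (i : Fin m) (x0 : ℝ) : Fam m := ⟨Function.update F.a i x0, F.b, F.c, F.d⟩

theorem Valid.ext {F : Fam m} (hF : F.Valid) {i : Fin m} {x0 : ℝ} (hx : x0 ≤ F.a i)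
    (hn : ∀ k, F.b k ≤ F.a i → F.c k < F.d i → F.d k ≤ F.c i) : (F.ext i x0).Valid := by
  have hle : ∀ k, (F.ext i x0).a k ≤ F.a k := by
    intro k
    by_cases h : k = i
    · subst h; simpa [Fam.ext] using hx
    · simp [Fam.ext, h]
  have hk : ∀ k, k ≠ i → (F.ext i x0).a k = F.a k := by
    intro k h
    simp [Fam.ext, h]
  have one : ∀ k, k ≠ i → F.b i ≤ F.a k ∨ F.b k ≤ (F.ext i x0).a i ∨ F.d i ≤ F.c k ∨
      F.d k ≤ F.c i := by
    intro k hki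
    rcases hF.dj i k (Ne.symm hki) with h | h | h | h
    · exact Or.inl h
    · by_cases h2 : F.c k < F.d i
      · exact Or.inr (Or.inr (Or.inr (hn k h h2)))
      · exact Or.inr (Or.inr (Or.inl (not_lt.1 h2)))
    · tauto
    · tauto
  refine ⟨fun k => (hle k).trans_lt (hF.ab k), hF.cd, fun j k hjk => ?_⟩
  show F.b j ≤ (F.ext i x0).a k ∨ F.b k ≤ (F.ext i x0).a j ∨ F.d j ≤ F.c k ∨ F.d k ≤ F.c j
  by_cases hj : j = i
  · subst hj
    rw [hk k (Ne.symm hjk)]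
    exact one k (Ne.symm hjk)
  · by_cases hk' : k = i
    · subst hk'
      rw [hk j hjk]
      have := one j hjk
      tauto
    · rw [hk j hj, hk k hk']
      exact hF.dj j k hjk

theorem Hole.ext {F : Fam m} (hF : F.Valid) {i : Fin m} {x0 : ℝ} (hx : x0 ≤ F.a i)
    (hn : ∀ k, F.b k ≤ F.a i → F.c k < F.d i → F.d k ≤ F.c i)
    {V : ℝ → ℝ → Prop} (h : F.Hole V) : (F.ext i x0).Hole V := by
  have mono : ∀ x y, F.Cov x y → (F.ext i x0).Cov x y := by
    rintro x y ⟨k, h1, h2, h3, h4⟩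
    refine ⟨k, ?_, h2, h3, h4⟩
    by_cases hk : k = i
    · subst hk
      simp only [Fam.ext, Function.update_self]; linarith
    · simpa [Fam.ext, hk] using h1
  refine ⟨h.ne, h.op, h.bd, ?_, ?_⟩
  · rintro x y hv ⟨k, h1, h2, h3, h4⟩
    by_cases hk : k = i
    swap
    · simp only [Fam.ext, ne_eq, hk, not_false_eq_true, Function.update_of_ne] at h1 h2 h3 h4
      exact h.free x y hv ⟨k, h1, h2, h3, h4⟩
    subst hk
    simp only [Fam.ext, Function.update_self] at h1 h2 h3 h4
    have hxa : x < F.a k := by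
      by_contra hc
      exact h.free x y hv ⟨k, by linarith, h2, h3, h4⟩
    obtain ⟨δ, hδ, H⟩ := h.op x y hv
    have hcd := hF.cd k
    obtain ⟨y', h5, h6⟩ : ∃ y', max (y - δ) (F.c k) < y' ∧ y' < min (y + δ) (F.d k) := by
      apply exists_between
      apply max_lt <;> apply lt_min <;> linarith
    rw [max_lt_iff] at h5
    rw [lt_min_iff] at h6
    have hv' : V x y' := H x y' (by simpa using hδ) (abs_lt.2 ⟨by linarith, by linarith⟩)
    obtain ⟨x', hx', j, g1, g2, g3, g4⟩ := h.left hv'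
    have hjk : j ≠ k := by rintro rfl; linarith
    have hab := hF.ab k
    rcases hF.dj j k hjk with e | e | e | e
    · linarith [hn j e (by linarith)]
    · linarith
    · linarith
    · linarith
  · intro I J hI hJ hf
    exact h.box I J hI hJ fun x hx y hy hc => hf x hx y hy (mono x y hc)

/-- Number of sides not on the walls. -/
noncomputable def defect (F : Fam m) (x0 x1 y0 y1 : ℝ) : ℕ :=
  Set.ncard {i | F.a i ≠ x0} + Set.ncard {i | F.b i ≠ x1} + Set.ncard {i | F.c i ≠ y0} +
    Set.ncard {i | F.d i ≠ y1}

theorem ncard_neg (f : Fin m → ℝ) (x : ℝ) :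
    Set.ncard {i | -f i ≠ -x} = Set.ncard {i | f i ≠ x} := by
  simp only [ne_eq, neg_inj]

/-- The bound holds for all hole systems of `F`. -/
def Good (F : Fam m) : Prop := ∀ (n : ℕ) (V : Fin n → ℝ → ℝ → Prop), (∀ i, F.Hole (V i)) →
  (∀ i j x y, V i x y → V j x y → i = j) → n + 3 ≤ m

theorem Good.of_flip {F : Fam m} (h : F.flip.Good) : F.Good := fun n V hV hd =>
  h n (fun i x y => V i y x) (fun i => (hV i).flip) (fun i j x y => hd i j y x)

theorem Good.of_negx {F : Fam m} (h : F.negx.Good) : F.Good := fun n V hV hd =>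
  h n (fun i x y => V i (-x) y) (fun i => (hV i).negx) (fun i j x y => hd i j (-x) y)

theorem Good.of_negy {F : Fam m} (h : F.negy.Good) : F.Good := fun n V hV hd =>
  h n (fun i x y => V i x (-y)) (fun i => (hV i).negy) (fun i j x y => hd i j x (-y))

theorem Good.of_ext {F : Fam m} (hF : F.Valid) {i : Fin m} {x0 : ℝ} (hx : x0 ≤ F.a i)
    (hn : ∀ k, F.b k ≤ F.a i → F.c k < F.d i → F.d k ≤ F.c i)
    (h : (F.ext i x0).Good) : F.Good := fun n V hV hd =>
  h n V (fun i => (hV i).ext hF hx hn) hd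


theorem good_or_satL {F : Fam m} (hF : F.Valid) {x0 x1 y0 y1 : ℝ} (hw : F.InWalls x0 x1 y0 y1)
    {N : ℕ} (hN : F.defect x0 x1 y0 y1 = N)
    (IH : ∀ (G : Fam m) (x0 x1 y0 y1 : ℝ), G.Valid → G.InWalls x0 x1 y0 y1 →
      G.defect x0 x1 y0 y1 < N → G.Good) :
    F.Good ∨ F.SatL x0 := by
  by_contra hcon
  rw [not_or] at hcon
  obtain ⟨h1, h2⟩ := hcon
  rw [SatL] at h2
  push Not at h2
  obtain ⟨i, hi, hk⟩ := h2
  refine h1 (Good.of_ext hF (hw.a i) hk (IH _ x0 x1 y0 y1 (hF.ext (hw.a i) hk)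
    ⟨fun k => ?_, hw.b, hw.c, hw.d⟩ ?_))
  · by_cases h : k = i
    · subst h; simp [Fam.ext]
    · simpa [Fam.ext, h] using hw.a k
  · rw [← hN]
    simp only [defect, Fam.ext]
    have : Set.ncard {k | Function.update F.a i x0 k ≠ x0} < Set.ncard {k | F.a k ≠ x0} := by
      apply Set.ncard_lt_ncard _ (Set.toFinite _)
      constructor
      · intro k hk
        by_cases h : k = i
        · subst h; simp at hk
        · simpa [h] using hk
      · intro hsub
        have := hsub (show i ∈ {k | F.a k ≠ x0} from hi)
        simp at this
    omega

theorem saturate (core : ∀ (F : Fam m) (x0 x1 y0 y1 : ℝ), F.Valid → F.InWalls x0 x1 y0 y1 →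
      F.SatL x0 → F.SatR x1 → F.SatD y0 → F.SatU y1 → F.Good) :
    ∀ (N : ℕ) (F : Fam m) (x0 x1 y0 y1 : ℝ), F.Valid → F.InWalls x0 x1 y0 y1 →
      F.defect x0 x1 y0 y1 = N → F.Good := by
  intro N
  induction N using Nat.strong_induction_on with
  | _ N IH' =>
  have IH : ∀ (G : Fam m) (x0 x1 y0 y1 : ℝ), G.Valid → G.InWalls x0 x1 y0 y1 →
      G.defect x0 x1 y0 y1 < N → G.Good := fun G x0 x1 y0 y1 h1 h2 h3 =>
    IH' _ h3 G x0 x1 y0 y1 h1 h2 rfl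
  intro F x0 x1 y0 y1 hF hw hN
  rcases good_or_satL hF hw hN IH with h | hL
  · exact h
  rcases good_or_satL (F := F.negx) (x0 := -x1) (x1 := -x0) (y0 := y0) (y1 := y1) hF.negx
    ⟨fun i => neg_le_neg (hw.b i), fun i => neg_le_neg (hw.a i), hw.c, hw.d⟩
    (by rw [← hN]; simp only [defect, Fam.negx, ncard_neg]; omega) IH with h | hR
  · exact h.of_negx
  rcases good_or_satL (F := F.flip) (x0 := y0) (x1 := y1) (y0 := x0) (y1 := x1) hF.flip
    ⟨hw.c, hw.d, hw.a, hw.b⟩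
    (by rw [← hN]; simp only [defect, Fam.flip]; omega) IH with h | hD
  · exact h.of_flip
  rcases good_or_satL (F := F.flip.negx) (x0 := -y1) (x1 := -y0) (y0 := x0) (y1 := x1) hF.flip.negx
    ⟨fun i => neg_le_neg (hw.d i), fun i => neg_le_neg (hw.c i), hw.a, hw.b⟩
    (by rw [← hN]; simp only [defect, Fam.flip, Fam.negx, ncard_neg]; omega) IH with h | hU
  · exact h.of_negx.of_flip
  refine core F x0 x1 y0 y1 hF hw hL ?_ hD ?_
  · intro i
    have := hR i
    simpa only [Fam.negx, neg_inj, neg_le_neg_iff] using this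
  · intro i
    have := hU i
    simpa only [Fam.negx, Fam.flip, neg_inj, neg_le_neg_iff] using this

end Fam

namespace Fam

variable {m : ℕ}

/-- In a saturated family, four distinct rectangles touch the four walls (Hall). -/
theorem exists_touching {F : Fam m} (hF : F.Valid) {x0 x1 y0 y1 : ℝ} (hm : 4 ≤ m)
    (hL : F.SatL x0) (hR : F.SatR x1) (hD : F.SatD y0) (hU : F.SatU y1) :
    ∃ A B C D : Fin m, F.a A = x0 ∧ F.c B = y0 ∧ F.b C = x1 ∧ F.d D = y1 ∧
      A ≠ D ∧ D ≠ C ∧ C ≠ B ∧ B ≠ A := by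
  classical
  let T : Fin 4 → Fin m → Prop :=
    ![fun i => F.a i = x0, fun i => F.c i = y0, fun i => F.b i = x1, fun i => F.d i = y1]
  let t : Fin 4 → Finset (Fin m) := fun s => Finset.univ.filter (T s)
  have hall : ∀ s : Finset (Fin 4), s.card ≤ (s.biUnion t).card := by
    intro s
    by_cases hX : s.biUnion t = Finset.univ
    · rw [hX, Finset.card_univ, Fintype.card_fin]
      exact (Finset.card_le_univ s).trans (by simpa using hm)
    let O : Finset (Fin m) := (s.biUnion t)ᶜ
    have hO : O.Nonempty := by
      rw [Finset.nonempty_iff_ne_empty]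
      intro h
      exact hX ((Finset.compl_eq_empty_iff _).1 h)
    have hOT : ∀ σ ∈ s, ∀ r ∈ O, ¬ T σ r := by
      intro σ hσ r hr h
      exact (Finset.mem_compl.1 hr) (Finset.mem_biUnion.2 ⟨σ, hσ, by simpa [t] using h⟩)
    let Q : Fin 4 → Fin m → Prop :=
      ![fun k => (∀ o ∈ O, F.b k ≤ F.a o) ∧ ∃ r ∈ O, F.c k < F.d r ∧ F.c r < F.d k,
        fun k => (∀ o ∈ O, F.d k ≤ F.c o) ∧ ∃ r ∈ O, F.a k < F.b r ∧ F.a r < F.b k,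
        fun k => (∀ o ∈ O, F.b o ≤ F.a k) ∧ ∃ r ∈ O, F.c k < F.d r ∧ F.c r < F.d k,
        fun k => (∀ o ∈ O, F.d o ≤ F.c k) ∧ ∃ r ∈ O, F.a k < F.b r ∧ F.a r < F.b k]
    have hQ : ∀ σ τ k, Q σ k → Q τ k → σ = τ := by
      intro σ τ k h1 h2
      fin_cases σ <;> fin_cases τ <;> (try rfl) <;> exfalso <;>
        obtain ⟨h1, r1, hr1, h3, h4⟩ := h1 <;> obtain ⟨h2, r2, hr2, h5, h6⟩ := h2 <;>
        linarith [h1 r1 hr1, h1 r2 hr2, h2 r1 hr1, h2 r2 hr2, hF.ab k, hF.cd k, hF.ab r1,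
          hF.ab r2, hF.cd r1, hF.cd r2]
    have hex : ∀ σ, ∃ k, σ ∈ s → k ∉ O ∧ Q σ k := by
      intro σ
      by_cases hσ : σ ∈ s
      swap
      · exact ⟨hO.choose, fun h => absurd h hσ⟩
      have hno := hOT σ hσ
      fin_cases σ
      · obtain ⟨r, hr, hmin⟩ := Finset.exists_min_image O F.a hO
        obtain ⟨k, h1, h2, h3⟩ := (hL r).resolve_left (hno r hr)
        refine ⟨k, fun _ => ⟨fun hk => ?_, fun o ho => ?_, r, hr, h2, h3⟩⟩
        · linarith [hmin k hk, hF.ab k]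
        · linarith [hmin o ho]
      · obtain ⟨r, hr, hmin⟩ := Finset.exists_min_image O F.c hO
        obtain ⟨k, h1, h2, h3⟩ := (hD r).resolve_left (hno r hr)
        refine ⟨k, fun _ => ⟨fun hk => ?_, fun o ho => ?_, r, hr, h2, h3⟩⟩
        · linarith [hmin k hk, hF.cd k]
        · linarith [hmin o ho]
      · obtain ⟨r, hr, hmin⟩ := Finset.exists_max_image O F.b hO
        obtain ⟨k, h1, h2, h3⟩ := (hR r).resolve_left (hno r hr)
        refine ⟨k, fun _ => ⟨fun hk => ?_, fun o ho => ?_, r, hr, h2, h3⟩⟩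
        · linarith [hmin k hk, hF.ab k]
        · linarith [hmin o ho]
      · obtain ⟨r, hr, hmin⟩ := Finset.exists_max_image O F.d hO
        obtain ⟨k, h1, h2, h3⟩ := (hU r).resolve_left (hno r hr)
        refine ⟨k, fun _ => ⟨fun hk => ?_, fun o ho => ?_, r, hr, h2, h3⟩⟩
        · linarith [hmin k hk, hF.cd k]
        · linarith [hmin o ho]
    choose κ hκ using hex
    refine Finset.card_le_card_of_injOn κ (fun σ hσ => ?_) (fun σ hσ τ hτ h => ?_)
    · have := (hκ σ hσ).1
      simpa only [O, Finset.mem_compl, not_not, Finset.mem_coe] using this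
    · refine hQ σ τ (κ σ) (hκ σ hσ).2 ?_
      rw [h]
      exact (hκ τ hτ).2
  obtain ⟨f, hf, hft⟩ := (Finset.all_card_le_biUnion_card_iff_exists_injective t).1 hall
  have h0 := hft 0
  have h1 := hft 1
  have h2 := hft 2
  have h3 := hft 3
  simp only [t, Finset.mem_filter, Finset.mem_univ, true_and] at h0 h1 h2 h3
  exact ⟨f 0, f 1, f 2, f 3, h0, h1, h2, h3, hf.ne (by decide), hf.ne (by decide),
    hf.ne (by decide), hf.ne (by decide)⟩

theorem Valid.good {F : Fam m} (hF : F.Valid) (hm : 4 ≤ m) : F.Good := by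
  have bdd : ∀ f : Fin m → ℝ, ∃ l u, (∀ i, l ≤ f i) ∧ ∀ i, f i ≤ u := by
    intro f
    obtain ⟨l, hl⟩ := (Set.finite_range f).bddBelow
    obtain ⟨u, hu⟩ := (Set.finite_range f).bddAbove
    exact ⟨l, u, fun i => hl ⟨i, rfl⟩, fun i => hu ⟨i, rfl⟩⟩
  obtain ⟨x0, -, h1, -⟩ := bdd F.a
  obtain ⟨-, x1, -, h2⟩ := bdd F.b
  obtain ⟨y0, -, h3, -⟩ := bdd F.c
  obtain ⟨-, y1, -, h4⟩ := bdd F.d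
  refine saturate ?_ _ F x0 x1 y0 y1 hF ⟨h1, h2, h3, h4⟩ rfl
  intro F x0 x1 y0 y1 hF hw hL hR hD hU n V hV hd
  obtain ⟨A, B, C, D, hA, hB, hC, hD', e1, e2, e3, e4⟩ := exists_touching hF hm hL hR hD hU
  exact count_of_extremal hF V hV hd (fun i => hA ▸ hw.a i) (fun i => hD' ▸ hw.d i)
    (fun i => hB ▸ hw.c i) (fun i => hC ▸ hw.b i) e1 e2 e3 e4

end Fam

theorem rect_bounded_holes_upper_bound (m : ℕ) (hm : 3 ≤ m)
    (Z : Fin m → Set (ℝ × ℝ)) (hZ : ∀ i, IsRect (Z i))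
    (hdisj : ∀ i j, i ≠ j → Disjoint (interior (Z i)) (interior (Z j))) :
    ({H : Set (ℝ × ℝ) | (∃ x ∈ (⋃ i, Z i)ᶜ,
        H = connectedComponentIn (⋃ i, Z i)ᶜ x) ∧ Bornology.IsBounded H}).Finite ∧
    ({H : Set (ℝ × ℝ) | (∃ x ∈ (⋃ i, Z i)ᶜ,
        H = connectedComponentIn (⋃ i, Z i)ᶜ x) ∧ Bornology.IsBounded H}).ncard
      ≤ m - 3 := by
  classical
  choose a b c d hab hcd hZe using hZ
  let F : Fam m := ⟨a, b, c, d⟩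
  have hF : F.Valid := by
    refine ⟨hab, hcd, fun i j hij => ?_⟩
    have h := hdisj i j hij
    rw [hZe i, hZe j, interior_prod_eq, interior_prod_eq, interior_Icc, interior_Icc, interior_Icc,
      interior_Icc] at h
    by_contra hcon
    simp only [F, not_or, not_le] at hcon
    obtain ⟨h1, h2, h3, h4⟩ := hcon
    have hi := hab i
    have hj := hab j
    have hi' := hcd i
    have hj' := hcd j
    obtain ⟨x, hx1, hx2⟩ : ∃ x, max (a i) (a j) < x ∧ x < min (b i) (b j) := by
      apply exists_between
      apply max_lt <;> apply lt_min <;> linarith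
    obtain ⟨y, hy1, hy2⟩ : ∃ y, max (c i) (c j) < y ∧ y < min (d i) (d j) := by
      apply exists_between
      apply max_lt <;> apply lt_min <;> linarith
    rw [max_lt_iff] at hx1 hy1
    rw [lt_min_iff] at hx2 hy2
    have hmem : (x, y) ∈ Set.Ioo (a i) (b i) ×ˢ Set.Ioo (c i) (d i) :=
      ⟨⟨hx1.1, hx2.1⟩, ⟨hy1.1, hy2.1⟩⟩
    exact Set.disjoint_left.1 h hmem ⟨⟨hx1.2, hx2.2⟩, ⟨hy1.2, hy2.2⟩⟩
  set W : Set (ℝ × ℝ) := (⋃ i, Z i)ᶜ with hW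
  have hWo : IsOpen W := by
    rw [hW, isOpen_compl_iff]
    refine isClosed_iUnion_of_finite fun i => ?_
    rw [hZe i]
    exact isClosed_Icc.prod isClosed_Icc
  have hcov : ∀ x y, (x, y) ∈ W ↔ ¬ F.Cov x y := by
    intro x y
    rw [hW, Set.mem_compl_iff, Set.mem_iUnion, not_iff_not]
    refine exists_congr fun i => ?_
    rw [hZe i]
    simp only [Set.mem_prod, Set.mem_Icc, F]
    tauto
  set S : Set (Set (ℝ × ℝ)) := {H : Set (ℝ × ℝ) | (∃ x ∈ W,
        H = connectedComponentIn W x) ∧ Bornology.IsBounded H} with hS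
  have hole : ∀ H ∈ S, F.Hole (fun x y => (x, y) ∈ H) := by
    rintro H ⟨⟨p, hp, rfl⟩, hbd⟩
    refine ⟨⟨p.1, p.2, mem_connectedComponentIn hp⟩, ?_, ?_, ?_, ?_⟩
    · intro x y hv
      obtain ⟨δ, hδ, hb⟩ := Metric.isOpen_iff.1 hWo.connectedComponentIn _ hv
      refine ⟨δ, hδ, fun x' y' h1 h2 => hb ?_⟩
      rw [Metric.mem_ball, Prod.dist_eq, max_lt_iff]
      exact ⟨h1, h2⟩
    · obtain ⟨M, hM⟩ := isBounded_iff_forall_norm_le.1 hbd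
      refine ⟨M + 1, fun x y hv => ?_⟩
      have h1 := hM _ hv
      rw [Prod.norm_def, max_le_iff] at h1
      simp only [Real.norm_eq_abs] at h1
      exact ⟨by linarith [h1.1], by linarith [h1.2]⟩
    · intro x y hv
      exact (hcov x y).1 (connectedComponentIn_subset _ _ hv)
    · intro I J hI hJ hf x hx y hy hv x' hx' y' hy'
      have hpre : IsPreconnected (I ×ˢ J) := hI.isPreconnected.prod hJ.isPreconnected
      have hsub : I ×ˢ J ⊆ W := by
        rintro ⟨u, v⟩ ⟨hu, hv⟩
        exact (hcov u v).2 (hf u hu v hv)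
      have h1 := hpre.subset_connectedComponentIn (x := (x, y)) ⟨hx, hy⟩ hsub
      rw [connectedComponentIn_eq hv]
      exact h1 ⟨hx', hy'⟩
  have hdis : ∀ H ∈ S, ∀ H' ∈ S, ∀ p, p ∈ H → p ∈ H' → H = H' := by
    rintro H ⟨⟨p, hp, rfl⟩, -⟩ H' ⟨⟨q, hq, rfl⟩, -⟩ r h1 h2
    rw [connectedComponentIn_eq h1, connectedComponentIn_eq h2]
  have bound : ∀ T : Finset (Set (ℝ × ℝ)), (T : Set (Set (ℝ × ℝ))) ⊆ S → T.card ≤ m - 3 := by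
    intro T hT
    by_cases h0 : T = ∅
    · subst h0; simp
    obtain ⟨H, hH⟩ := Finset.nonempty_iff_ne_empty.2 h0
    have h4 := (hole H (hT hH)).four
    have e := T.equivFin.symm
    have := hF.good h4 T.card (fun i x y => (x, y) ∈ (e i : Set (ℝ × ℝ)))
      (fun i => hole _ (hT (e i).2))
      (fun i j x y h1 h2 => e.injective (Subtype.ext (hdis _ (hT (e i).2) _ (hT (e j).2) _ h1 h2)))
    omega
  have hfin : S.Finite := by
    by_contra hinf
    obtain ⟨T, hT, hc⟩ := (Set.not_finite.1 hinf : S.Infinite).exists_subset_card_eq (m - 3 + 1)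
    have := bound T hT
    omega
  refine ⟨hfin, ?_⟩
  rw [Set.ncard_eq_toFinset_card S hfin]
  exact bound _ (by simp)
end
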